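/- arXiv:2407.13736 — 5 statements merged into one kernel-verified Lean document; each statement's English description precedes it below -/
import Mathlib

section
/- Let m_𝔳 be a positive even integer and m_𝔷 a positive integer; set Q = m_𝔳/2 + m_𝔷. Let A(s) = 2^{m_𝔳 + m_𝔷} (sinh(s/2))^{m_𝔳 + m_𝔷} (cosh(s/2))^{m_𝔷}. Let B > 2 and 0 < R₀ < R. Then there exists C > 0, depending only on m_𝔳, m_𝔷, B, R₀ and R, such that for every Lebesgue-measurable t : (0,∞) → (0, 4/Q²) and every measurable ψ : [R₀, R] → ℂ with |ψ(s)| = 1 for all s: ∫_{B/R₀}^∞ (λ² + Q²/4)^{-1/4} | ∫_{R₀}^{R} ψ(s) A(s)^{1/2} e^{i(λ s + t(s)(λ² + Q²/4))} ds |² dλ ≤ C. -/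
open MeasureTheory
open scoped ENNReal NNReal

/-- The homogeneous dimension `Q = mv/2 + mz` of a Damek-Ricci space. -/
noncomputable def homDim (mv mz : ℕ) : ℝ := (mv : ℝ) / 2 + (mz : ℝ)

/-- The radial density `A(s) = 2^{mv+mz} sinh(s/2)^{mv+mz} cosh(s/2)^{mz}` of the left Haar
measure of a Damek-Ricci space with `dim 𝔳 = mv`, `dim 𝔷 = mz`. -/
noncomputable def radialDensity (mv mz : ℕ) (s : ℝ) : ℝ :=
  2 ^ (mv + mz) * Real.sinh (s / 2) ^ (mv + mz) * Real.cosh (s / 2) ^ mz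

lemma norm_cexp_I_mul (r : ℝ) : ‖Complex.exp (Complex.I * (r : ℂ))‖ = 1 := by
  rw [mul_comm, Complex.norm_exp_ofReal_mul_I]

lemma norm_integral_mul_exp_le_of_le_abs_deriv {w w' : ℝ → ℝ}
    (hw : ∀ l, HasDerivAt w (w' l) l) (hw'c : Continuous w') (hw0 : ∀ l, 0 ≤ w l)
    {c d : ℝ} (hcd : c ≤ d) (hw' : ∀ l ∈ Set.Icc c d, w' l ≤ 0)
    {x y κ m : ℝ} (hm : 0 < m) (h : ∀ l ∈ Set.Icc c d, m ≤ |x + 2 * y * l|) :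
    ‖∫ l in c..d, (w l : ℂ) * Complex.exp (Complex.I * ((x * l + y * (l ^ 2 + κ) : ℝ) : ℂ))‖
      ≤ 5 * w c / m := by
  have hwc : Continuous w := continuous_iff_continuousAt.2 fun l => (hw l).continuousAt
  set p : ℝ → ℝ := fun l => x + 2 * y * l with hp
  set e : ℝ → ℂ := fun l => Complex.exp (Complex.I * ((x * l + y * (l ^ 2 + κ) : ℝ) : ℂ)) with he
  have hec : Continuous e := by fun_prop
  have hpc : Continuous p := by fun_prop
  have hne : ∀ l ∈ Set.Icc c d, p l ≠ 0 := fun l hl h0 => by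
    have := h l hl
    simp only [hp] at h0
    rw [h0, abs_zero] at this
    linarith
  have hpd : ∀ l, HasDerivAt p (2 * y) l := fun l => by
    exact (((hasDerivAt_id' l).const_mul (2 * y)).const_add x).congr_deriv (mul_one _)
  have hud : ∀ l ∈ Set.Icc c d, HasDerivAt (fun l => (p l)⁻¹) (-(2 * y) / p l ^ 2) l :=
    fun l hl => (hpd l).inv (hne l hl)
  have hinv : ∀ l ∈ Set.Icc c d, |(p l)⁻¹| ≤ m⁻¹ := fun l hl => by
    rw [abs_inv]
    exact inv_anti₀ hm (h l hl)
  have hed : ∀ l, HasDerivAt e (Complex.I * (p l : ℂ) * e l) l := fun l => by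
    have h1 : HasDerivAt (fun l : ℝ => x * l + y * (l ^ 2 + κ)) (p l) l := by
      refine (((hasDerivAt_id' l).const_mul x).add
        ((((hasDerivAt_id' l).pow 2).add_const κ).const_mul y)).congr_deriv ?_
      simp only [hp]; ring
    refine (h1.ofReal_comp.const_mul Complex.I).cexp.congr_deriv ?_
    simp only [he]; ring
  have hanti : ∀ l ∈ Set.Icc c d, w l ≤ w c := by
    have : AntitoneOn w (Set.Icc c d) := by
      apply antitoneOn_of_deriv_nonpos (convex_Icc c d) hwc.continuousOn
      · exact fun l _ => (hw l).differentiableAt.differentiableWithinAt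
      · intro l hl
        rw [(hw l).deriv]
        exact hw' l (interior_subset hl)
    exact fun l hl => this (Set.left_mem_Icc.2 hcd) hl hl.1
  set g' : ℝ → ℝ := fun l => w' l * (p l)⁻¹ + w l * (-(2 * y) / p l ^ 2) with hg'
  have hgd : ∀ l ∈ Set.Icc c d, HasDerivAt (fun l => ((w l * (p l)⁻¹ : ℝ) : ℂ) * e l)
      ((g' l : ℂ) * e l + Complex.I * ((w l : ℂ) * e l)) l := fun l hl => by
    refine (((hw l).mul (hud l hl)).ofReal_comp.mul (hed l)).congr_deriv ?_
    have h0 : (p l : ℂ) ≠ 0 := by exact_mod_cast hne l hl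
    simp only [hg', Pi.mul_apply]
    push_cast
    field_simp
  have huIcc : Set.uIcc c d = Set.Icc c d := Set.uIcc_of_le hcd
  have hg'c : ContinuousOn g' (Set.Icc c d) := by
    refine (hw'c.continuousOn.mul (hpc.continuousOn.inv₀ hne)).add
      (hwc.continuousOn.mul (continuousOn_const.div (hpc.pow 2).continuousOn ?_))
    exact fun l hl => pow_ne_zero 2 (hne l hl)
  have hi1 : IntervalIntegrable (fun l => (g' l : ℂ) * e l) volume c d := by
    apply ContinuousOn.intervalIntegrable
    rw [huIcc]
    exact (Complex.continuous_ofReal.comp_continuousOn hg'c).mul hec.continuousOn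
  have hi2 : IntervalIntegrable (fun l => Complex.I * ((w l : ℂ) * e l)) volume c d := by
    apply Continuous.intervalIntegrable
    fun_prop
  have hftc := intervalIntegral.integral_eq_sub_of_hasDerivAt
    (fun l hl => hgd l (huIcc ▸ hl)) (hi1.add hi2)
  rw [intervalIntegral.integral_add hi1 hi2, intervalIntegral.integral_const_mul] at hftc
  have hen : ∀ l, ‖e l‖ = 1 := fun l => norm_cexp_I_mul _
  obtain ⟨s, hs, hsy⟩ : ∃ s : ℝ, |s| = 1 ∧ |y| = s * y := by
    rcases abs_choice y with h | h
    · exact ⟨1, by simp, by simp [h]⟩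
    · exact ⟨-1, by simp, by simp [h]⟩
  set H' : ℝ → ℝ := fun l => -(w' l) / m + w c * s * -(-(2 * y) / p l ^ 2) with hH'
  have hHd : ∀ l ∈ Set.Icc c d,
      HasDerivAt (fun l => -(w l) / m + w c * s * -(p l)⁻¹) (H' l) l := fun l hl =>
    ((hw l).neg.div_const m).add ((hud l hl).neg.const_mul _)
  have hHi : IntervalIntegrable H' volume c d := by
    apply ContinuousOn.intervalIntegrable
    rw [huIcc]
    refine (hw'c.neg.div_const m).continuousOn.add
      (continuousOn_const.mul (continuousOn_const.div (hpc.pow 2).continuousOn ?_).neg)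
    exact fun l hl => pow_ne_zero 2 (hne l hl)
  have hHint := intervalIntegral.integral_eq_sub_of_hasDerivAt
    (fun l hl => hHd l (huIcc ▸ hl)) hHi
  have hle : ‖∫ l in c..d, (g' l : ℂ) * e l‖ ≤ ∫ l in c..d, H' l := by
    apply intervalIntegral.norm_integral_le_of_norm_le hcd _ hHi
    filter_upwards with l hl
    have hl' := Set.Ioc_subset_Icc_self hl
    rw [norm_mul, hen, mul_one, Complex.norm_real, Real.norm_eq_abs]
    refine (abs_add_le _ _).trans (add_le_add ?_ ?_)
    · rw [abs_mul, abs_of_nonpos (hw' l hl'), div_eq_mul_inv]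
      exact mul_le_mul_of_nonneg_left (hinv l hl') (by linarith [hw' l hl'])
    · rw [abs_mul, abs_of_nonneg (hw0 l), abs_div, abs_neg, abs_mul, abs_two,
        abs_of_nonneg (sq_nonneg (p l)), hsy]
      have : w c * s * -(-(2 * y) / p l ^ 2) = w c * (2 * (s * y) / p l ^ 2) := by ring
      rw [this]
      refine mul_le_mul_of_nonneg_right (hanti l hl') ?_
      rw [← hsy]; positivity
  have hcI := Set.left_mem_Icc.2 hcd
  have hdI := Set.right_mem_Icc.2 hcd
  have hG : ∀ l ∈ Set.Icc c d, ‖((w l * (p l)⁻¹ : ℝ) : ℂ) * e l‖ ≤ w c * m⁻¹ := fun l hl => by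
    rw [norm_mul, hen, mul_one, Complex.norm_real, Real.norm_eq_abs, abs_mul,
      abs_of_nonneg (hw0 l)]
    exact mul_le_mul (hanti l hl) (hinv l hl) (abs_nonneg _) (hw0 c)
  have hHb : ∫ l in c..d, H' l ≤ 3 * (w c * m⁻¹) := by
    rw [hHint]
    have h1 : ∀ l ∈ Set.Icc c d, |w c * s * (p l)⁻¹| ≤ w c * m⁻¹ := fun l hl => by
      rw [abs_mul, abs_mul, hs, mul_one, abs_of_nonneg (hw0 c)]
      exact mul_le_mul_of_nonneg_left (hinv l hl) (hw0 c)
    have := abs_le.1 (h1 c hcI)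
    have := abs_le.1 (h1 d hdI)
    have : 0 ≤ w d * m⁻¹ := mul_nonneg (hw0 d) (inv_nonneg.2 hm.le)
    simp only [div_eq_mul_inv]
    linarith
  have hfin : ‖Complex.I * ∫ l in c..d, (w l : ℂ) * e l‖ ≤ 5 * w c / m := by
    rw [eq_sub_of_add_eq' hftc]
    refine (norm_sub_le _ _).trans ?_
    have := norm_sub_le (((w d * (p d)⁻¹ : ℝ) : ℂ) * e d) (((w c * (p c)⁻¹ : ℝ) : ℂ) * e c)
    have := hG c hcI
    have := hG d hdI
    have : 5 * w c / m = 5 * (w c * m⁻¹) := by ring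
    linarith
  rwa [norm_mul, Complex.norm_I, one_mul] at hfin

lemma norm_integral_le_add_of_split {f : ℝ → ℂ} (hf : Continuous f) {c d p K₁ K₂ : ℝ}
    (hcd : c ≤ d) (hK₁ : 0 ≤ K₁) (hK₂ : 0 ≤ K₂)
    (h₁ : ∀ d', c ≤ d' → d' ≤ d → d' ≤ p → ‖∫ l in c..d', f l‖ ≤ K₁)
    (h₂ : ∀ c', c ≤ c' → c' ≤ d → p ≤ c' → ‖∫ l in c'..d, f l‖ ≤ K₂) :
    ‖∫ l in c..d, f l‖ ≤ K₁ + K₂ := by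
  rcases le_total d p with hd | hd
  · linarith [h₁ d hcd le_rfl hd]
  rcases le_total p c with hc | hc
  · linarith [h₂ c le_rfl hcd hc]
  rw [← intervalIntegral.integral_add_adjacent_intervals (hf.intervalIntegrable c p)
    (hf.intervalIntegrable p d)]
  exact (norm_add_le _ _).trans (add_le_add (h₁ p hc hd le_rfl) (h₂ p hc hd le_rfl))

lemma norm_integral_mul_exp_le_of_le {w : ℝ → ℝ} (hw0 : ∀ l, 0 ≤ w l) (φ : ℝ → ℝ) {c d M : ℝ}
    (hcd : c ≤ d) (hM : ∀ l ∈ Set.Icc c d, w l ≤ M) :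
    ‖∫ l in c..d, (w l : ℂ) * Complex.exp (Complex.I * (φ l : ℂ))‖ ≤ M * (d - c) := by
  rw [← abs_of_nonneg (sub_nonneg.2 hcd)]
  apply intervalIntegral.norm_integral_le_of_norm_le_const
  intro l hl
  rw [norm_mul, norm_cexp_I_mul, mul_one, Complex.norm_real, Real.norm_eq_abs,
    abs_of_nonneg (hw0 l)]
  rw [Set.uIoc_of_le hcd] at hl
  exact hM l (Set.Ioc_subset_Icc_self hl)

lemma norm_integral_mul_exp_le_two_mul_sqrt {w : ℝ → ℝ} (hw0 : ∀ l, 0 ≤ w l)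
    (hwb : ∀ l, 0 < l → w l ≤ 1 / √l) (φ : ℝ → ℝ) {c d : ℝ} (hc : 0 < c) (hcd : c ≤ d) :
    ‖∫ l in c..d, (w l : ℂ) * Complex.exp (Complex.I * (φ l : ℂ))‖ ≤ 2 * √d := by
  have hpos : ∀ l ∈ Set.uIcc c d, 0 < l := fun l hl => by
    rw [Set.uIcc_of_le hcd] at hl
    exact hc.trans_le hl.1
  have hi : IntervalIntegrable (fun l : ℝ => 1 / √l) volume c d := by
    apply ContinuousOn.intervalIntegrable
    refine continuousOn_const.div Real.continuous_sqrt.continuousOn ?_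
    exact fun l hl => (Real.sqrt_pos.2 (hpos l hl)).ne'
  have hint : ∫ l in c..d, 1 / √l = 2 * √d - 2 * √c := by
    refine intervalIntegral.integral_eq_sub_of_hasDerivAt (f := fun l => 2 * √l) (fun l hl => ?_) hi
    refine ((Real.hasDerivAt_sqrt (hpos l hl).ne').const_mul 2).congr_deriv ?_
    field_simp
  have hle : ‖∫ l in c..d, (w l : ℂ) * Complex.exp (Complex.I * (φ l : ℂ))‖
      ≤ ∫ l in c..d, 1 / √l := by
    apply intervalIntegral.norm_integral_le_of_norm_le hcd _ hi
    filter_upwards with l hl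
    rw [norm_mul, norm_cexp_I_mul, mul_one, Complex.norm_real, Real.norm_eq_abs,
      abs_of_nonneg (hw0 l)]
    exact hwb l (hc.trans hl.1)
  linarith [Real.sqrt_nonneg c]

/-- Van der Corput type bound, uniform in the quadratic coefficient and in the interval. -/
lemma norm_integral_mul_exp_quadratic_le_of_pos {w w' : ℝ → ℝ}
    (hw : ∀ l, HasDerivAt w (w' l) l) (hw'c : Continuous w') (hw0 : ∀ l, 0 ≤ w l)
    (hw' : ∀ l, 0 < l → w' l ≤ 0) (hwb : ∀ l, 0 < l → w l ≤ 1 / √l)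
    {x y κ c d : ℝ} (hx : 0 < x) (hc : 0 < c) (hcd : c ≤ d) :
    ‖∫ l in c..d, (w l : ℂ) * Complex.exp (Complex.I * ((x * l + y * (l ^ 2 + κ) : ℝ) : ℂ))‖
      ≤ 30 / √x := by
  have hwc : Continuous w := continuous_iff_continuousAt.2 fun l => (hw l).continuousAt
  have hfc : Continuous fun l => (w l : ℂ) *
      Complex.exp (Complex.I * ((x * l + y * (l ^ 2 + κ) : ℝ) : ℂ)) := by fun_prop
  set r := √x with hr
  have hr0 : 0 < r := Real.sqrt_pos.2 hx
  have hxr : x = r ^ 2 := (Real.sq_sqrt hx.le).symm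
  have key : ∀ {c' d' m}, 0 < c' → c' ≤ d' → 0 < m →
      (∀ l ∈ Set.Icc c' d', m ≤ |x + 2 * y * l|) →
      ‖∫ l in c'..d', (w l : ℂ) *
        Complex.exp (Complex.I * ((x * l + y * (l ^ 2 + κ) : ℝ) : ℂ))‖ ≤ 5 * w c' / m :=
    fun hc' hcd' hm h => norm_integral_mul_exp_le_of_le_abs_deriv hw hw'c hw0 hcd'
      (fun l hl => hw' l (hc'.trans_le hl.1)) hm h
  have hw1 : ∀ {l k : ℝ}, 0 < k → k ^ 2 ≤ l → w l ≤ 1 / k := fun {l k} hk hkl => by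
    refine (hwb l ((pow_pos hk 2).trans_le hkl)).trans ?_
    exact one_div_le_one_div_of_le hk (Real.le_sqrt_of_sq_le hkl)
  have hw2 : ∀ {l}, 1 / x ≤ l → w l ≤ r := fun {l} hl => by
    have := hw1 (l := l) (one_div_pos.2 hr0) (by rwa [div_pow, one_pow, ← hxr])
    rwa [one_div_one_div] at this
  have h30 : 30 / r = 2 / r + (10 / r + (18 / r)) := by ring
  rw [h30]
  refine norm_integral_le_add_of_split (p := 1 / x) hfc hcd (by positivity) (by positivity) ?_ ?_
  · intro d' hcd' _ hd'
    refine (norm_integral_mul_exp_le_two_mul_sqrt hw0 hwb _ hc hcd').trans ?_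
    have : √d' ≤ 1 / r :=
      Real.sqrt_le_iff.2 ⟨by positivity, by rwa [div_pow, one_pow, ← hxr]⟩
    calc 2 * √d' ≤ 2 * (1 / r) := by gcongr
      _ = 2 / r := by ring
  clear hcd
  intro c₁ hcc₁ hcd hxc₁
  have hc₁ : 0 < c₁ := hc.trans_le hcc₁
  have half : ∀ {c' d'}, c₁ ≤ c' → c' ≤ d' → (∀ l ∈ Set.Icc c' d', x / 2 ≤ |x + 2 * y * l|) →
      ‖∫ l in c'..d', (w l : ℂ) *
        Complex.exp (Complex.I * ((x * l + y * (l ^ 2 + κ) : ℝ) : ℂ))‖ ≤ 10 / r := by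
    intro c' d' hcc' hcd' h
    refine (key (hc₁.trans_le hcc') hcd' (half_pos hx) h).trans ?_
    calc 5 * w c' / (x / 2) ≤ 5 * r / (x / 2) := by
          have := hw2 (hxc₁.trans hcc')
          gcongr
      _ = 10 / r := by rw [hxr]; field_simp; norm_num
  rcases le_or_gt 0 y with hy | hy
  · refine (half le_rfl hcd fun l hl => ?_).trans (le_add_of_nonneg_right (by positivity))
    have : 0 ≤ y * l := mul_nonneg hy (hc₁.le.trans hl.1)
    exact le_trans (by linarith) (le_abs_self _)
  set k := √(-y) with hk
  have hk0 : 0 < k := Real.sqrt_pos.2 (neg_pos.2 hy)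
  have hyk : y = -k ^ 2 := by rw [hk, Real.sq_sqrt (neg_pos.2 hy).le, neg_neg]
  set l₀ := r ^ 2 / (2 * k ^ 2) with hl₀
  have hφ : ∀ l, x + 2 * y * l = 2 * k ^ 2 * (l₀ - l) := fun l => by
    rw [hxr, hyk, hl₀]; field_simp; ring
  refine norm_integral_le_add_of_split (p := l₀ / 2) hfc hcd (by positivity) (by positivity) ?_ ?_
  · intro d' hcd' _ hd'
    refine half le_rfl hcd' fun l hl => ?_
    have : x = 2 * k ^ 2 * l₀ := by have := hφ 0; simpa using this
    rw [hφ, this]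
    have : 2 * k ^ 2 * l₀ / 2 = 2 * k ^ 2 * (l₀ / 2) := by ring
    rw [this]
    refine le_trans (mul_le_mul_of_nonneg_left ?_ (by positivity)) (le_abs_self _)
    linarith [hl.2]
  clear hcd
  intro c₂ hcc₂ hcd hlc₂
  have hw3 : ∀ {l}, c₂ ≤ l → w l ≤ 2 * k / r := fun {l} hl => by
    have := hw1 (l := l) (k := r / (2 * k)) (by positivity) (by
      refine le_trans (le_of_eq ?_) (hlc₂.trans hl)
      rw [hl₀]; field_simp)
    rwa [one_div_div] at this
  have outer : ∀ {c' d'}, c₂ ≤ c' → c' ≤ d' → (∀ l ∈ Set.Icc c' d', 1 / k ≤ |l₀ - l|) →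
      ‖∫ l in c'..d', (w l : ℂ) *
        Complex.exp (Complex.I * ((x * l + y * (l ^ 2 + κ) : ℝ) : ℂ))‖ ≤ 5 / r := by
    intro c' d' hcc' hcd' h
    refine (key (m := 2 * k) (hc₁.trans_le (hcc₂.trans hcc')) hcd' (by positivity)
      fun l hl => ?_).trans ?_
    · rw [hφ, abs_mul, abs_of_pos (by positivity : 0 < 2 * k ^ 2)]
      calc 2 * k = 2 * k ^ 2 * (1 / k) := by field_simp
        _ ≤ _ := mul_le_mul_of_nonneg_left (h l hl) (by positivity)
    · calc 5 * w c' / (2 * k) ≤ 5 * (2 * k / r) / (2 * k) := by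
            have := hw3 hcc'
            gcongr
        _ = 5 / r := by field_simp
  have h18 : 18 / r = 5 / r + (8 / r + 5 / r) := by ring
  rw [h18]
  refine norm_integral_le_add_of_split (p := l₀ - 1 / k) hfc hcd (by positivity) (by positivity)
    ?_ ?_
  · intro d' hcd' _ hd'
    refine outer le_rfl hcd' fun l hl => le_trans ?_ (le_abs_self _)
    linarith [hl.2]
  clear hcd
  intro c₃ hcc₃ hcd hlc₃
  refine norm_integral_le_add_of_split (p := l₀ + 1 / k) hfc hcd (by positivity) (by positivity)
    ?_ ?_
  · intro d' hcd' _ hd'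
    refine (norm_integral_mul_exp_le_of_le hw0 _ hcd'
      fun l hl => hw3 (hcc₃.trans hl.1)).trans ?_
    calc 2 * k / r * (d' - c₃) ≤ 2 * k / r * (4 / k) := by
          apply mul_le_mul_of_nonneg_left _ (by positivity)
          have : 4 / k = 4 * (1 / k) := by ring
          have : 0 < 1 / k := by positivity
          linarith
      _ = 8 / r := by field_simp; norm_num
  · intro c₄ hcc₄ hcd' hlc₄
    refine outer (hcc₃.trans hcc₄) hcd' fun l hl => le_trans ?_ (neg_le_abs _)
    linarith [hl.1]

lemma norm_integral_mul_exp_quadratic_le {w w' : ℝ → ℝ}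
    (hw : ∀ l, HasDerivAt w (w' l) l) (hw'c : Continuous w') (hw0 : ∀ l, 0 ≤ w l)
    (hw' : ∀ l, 0 < l → w' l ≤ 0) (hwb : ∀ l, 0 < l → w l ≤ 1 / √l)
    {x y κ c d : ℝ} (hx : x ≠ 0) (hc : 0 < c) (hcd : c ≤ d) :
    ‖∫ l in c..d, (w l : ℂ) * Complex.exp (Complex.I * ((x * l + y * (l ^ 2 + κ) : ℝ) : ℂ))‖
      ≤ 30 / √|x| := by
  rcases hx.lt_or_gt with hx | hx
  · have := norm_integral_mul_exp_quadratic_le_of_pos hw hw'c hw0 hw' hwb (y := -y) (κ := κ)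
      (neg_pos.2 hx) hc hcd
    rw [abs_of_neg hx]
    refine le_trans (le_of_eq ?_) this
    rw [← Complex.norm_conj, ← intervalIntegral.intervalIntegral_conj]
    congr 2
    ext l
    rw [map_mul, Complex.conj_ofReal, ← Complex.exp_conj, map_mul, Complex.conj_I,
      Complex.conj_ofReal]
    congr 2
    push_cast
    ring
  · rw [abs_of_pos hx]
    exact norm_integral_mul_exp_quadratic_le_of_pos hw hw'c hw0 hw' hwb hx hc hcd

lemma setLIntegral_mul_sq_le_lintegral_prod {w w' : ℝ → ℝ}
    (hw : ∀ l, HasDerivAt w (w' l) l) (hw'c : Continuous w') (hw0 : ∀ l, 0 ≤ w l)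
    (hw' : ∀ l, 0 < l → w' l ≤ 0) (hwb : ∀ l, 0 < l → w l ≤ 1 / √l)
    {μ : Measure ℝ} [IsFiniteMeasure μ] {f : ℝ → ℂ} (hf : Measurable f) {M : ℝ}
    (hM : ∀ s, ‖f s‖ ≤ M) {t : ℝ → ℝ} (ht : Measurable t) (κ : ℝ) {c d : ℝ}
    (hc : 0 < c) (hcd : c ≤ d) :
    ∫⁻ l in Set.Ioc c d, ENNReal.ofReal (w l) *
        (‖∫ s, f s * Complex.exp (Complex.I * ((l * s + t s * (l ^ 2 + κ) : ℝ) : ℂ)) ∂μ‖₊ :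
          ℝ≥0∞) ^ 2
      ≤ ∫⁻ z, ENNReal.ofReal (30 * M ^ 2) * ‖z.1 - z.2‖ₑ ^ (-(1 / 2) : ℝ) ∂(μ.prod μ) := by
  have hwc : Continuous w := continuous_iff_continuousAt.2 fun l => (hw l).continuousAt
  have hM0 : 0 ≤ M := (norm_nonneg _).trans (hM 0)
  set ν : Measure ℝ := volume.restrict (Set.Ioc c d) with hν
  set g : ℝ → ℝ → ℂ := fun l s =>
    f s * Complex.exp (Complex.I * ((l * s + t s * (l ^ 2 + κ) : ℝ) : ℂ)) with hg
  have hgM : ∀ l s, ‖g l s‖ ≤ M := fun l s => by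
    simp only [hg]
    rw [norm_mul, norm_cexp_I_mul, mul_one]
    exact hM s
  have hgm : Measurable fun p : ℝ × ℝ => g p.1 p.2 := by
    simp only [hg]; fun_prop
  set G : ℝ → ℝ × ℝ → ℂ := fun l z => (w l : ℂ) * (g l z.1 * (starRingEnd ℂ) (g l z.2)) with hG
  have hGi : Integrable (Function.uncurry G) (ν.prod (μ.prod μ)) := by
    have hwi : Integrable (fun l => (w l : ℂ)) ν :=
      (Complex.continuous_ofReal.comp hwc).integrableOn_Ioc
    refine (hwi.comp_fst (μ.prod μ)).mul_bdd (c := M * M) ?_ ?_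
    · refine Measurable.aestronglyMeasurable ?_
      refine (hgm.comp (measurable_fst.prodMk (measurable_fst.comp measurable_snd))).mul
        (Complex.continuous_conj.measurable.comp
          (hgm.comp (measurable_fst.prodMk (measurable_snd.comp measurable_snd))))
    · refine Filter.Eventually.of_forall fun p => ?_
      rw [norm_mul, Complex.norm_conj]
      exact mul_le_mul (hgM _ _) (hgM _ _) (norm_nonneg _) hM0
  have hGz : ∀ l, ∫ z, G l z ∂(μ.prod μ) = ((w l * ‖∫ s, g l s ∂μ‖ ^ 2 : ℝ) : ℂ) := fun l => by
    simp only [hG]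
    rw [integral_const_mul, integral_prod_mul (g l) (fun s => (starRingEnd ℂ) (g l s)),
      integral_conj, Complex.mul_conj, Complex.normSq_eq_norm_sq]
    push_cast; rfl
  have hGi1 : Integrable (fun l => ((w l * ‖∫ s, g l s ∂μ‖ ^ 2 : ℝ) : ℂ)) ν := by
    refine hGi.integral_prod_left.congr (Filter.Eventually.of_forall fun l => ?_)
    exact hGz l
  have hGi2 : Integrable (fun l => w l * ‖∫ s, g l s ∂μ‖ ^ 2) ν := by
    simpa only [RCLike.re_to_complex, Complex.ofReal_re] using hGi1.re
  have hnn : ∀ l, 0 ≤ w l * ‖∫ s, g l s ∂μ‖ ^ 2 := fun l => mul_nonneg (hw0 l) (sq_nonneg _)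
  calc ∫⁻ l, ENNReal.ofReal (w l) * (‖∫ s, g l s ∂μ‖₊ : ℝ≥0∞) ^ 2 ∂ν
      = ∫⁻ l, ENNReal.ofReal (w l * ‖∫ s, g l s ∂μ‖ ^ 2) ∂ν := by
        congr 1; ext l
        rw [ENNReal.ofReal_mul (hw0 l), ENNReal.ofReal_pow (norm_nonneg _),
          ofReal_norm, enorm_eq_nnnorm]
    _ = ‖∫ l, ∫ z, G l z ∂(μ.prod μ) ∂ν‖ₑ := by
        rw [← ofReal_integral_eq_lintegral_ofReal hGi2 (Filter.Eventually.of_forall hnn)]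
        simp only [hGz]
        rw [integral_complex_ofReal, ← ofReal_norm, Complex.norm_real,
          Real.norm_of_nonneg (integral_nonneg hnn)]
    _ = ‖∫ z, ∫ l, G l z ∂ν ∂(μ.prod μ)‖ₑ := by rw [integral_integral_swap hGi]
    _ ≤ ∫⁻ z, ‖∫ l, G l z ∂ν‖ₑ ∂(μ.prod μ) := enorm_integral_le_lintegral_enorm _
    _ ≤ _ := lintegral_mono fun z => ?_
  rcases eq_or_ne (z.1 - z.2) 0 with hz | hz
  · rcases hM0.eq_or_lt with h0 | h0
    · have : ∀ s, f s = 0 := fun s => norm_le_zero_iff.1 (h0 ▸ hM s)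
      simp [hG, hg, this]
    · have : ENNReal.ofReal (30 * M ^ 2) ≠ 0 := by
        rw [Ne, ENNReal.ofReal_eq_zero, not_le]; positivity
      simp only [hz, enorm_zero]
      rw [ENNReal.zero_rpow_of_neg (by norm_num), ENNReal.mul_top this]
      exact le_top
  have hGl : ∀ l, G l z = (f z.1 * (starRingEnd ℂ) (f z.2)) * ((w l : ℂ) * Complex.exp (Complex.I *
      (((z.1 - z.2) * l + (t z.1 - t z.2) * (l ^ 2 + κ) : ℝ) : ℂ))) := fun l => by
    simp only [hG, hg]
    rw [map_mul, ← Complex.exp_conj, map_mul, Complex.conj_I, Complex.conj_ofReal]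
    have : Complex.exp (Complex.I *
        (((z.1 - z.2) * l + (t z.1 - t z.2) * (l ^ 2 + κ) : ℝ) : ℂ)) =
        Complex.exp (Complex.I * ((l * z.1 + t z.1 * (l ^ 2 + κ) : ℝ) : ℂ)) *
        Complex.exp (-Complex.I * ((l * z.2 + t z.2 * (l ^ 2 + κ) : ℝ) : ℂ)) := by
      rw [← Complex.exp_add]; congr 1; push_cast; ring
    rw [this]; ring
  simp only [hGl]
  rw [integral_const_mul, ← ofReal_norm, norm_mul, norm_mul, Complex.norm_conj, hν,
    ← intervalIntegral.integral_of_le hcd, ← ofReal_norm, Real.norm_eq_abs,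
    ENNReal.ofReal_rpow_of_pos (abs_pos.2 hz), ← ENNReal.ofReal_mul (by positivity)]
  apply ENNReal.ofReal_le_ofReal
  rw [Real.rpow_neg (abs_nonneg _), ← Real.sqrt_eq_rpow]
  calc _ ≤ M * M * (30 / √|z.1 - z.2|) := mul_le_mul
        (mul_le_mul (hM _) (hM _) (norm_nonneg _) hM0)
        (norm_integral_mul_exp_quadratic_le hw hw'c hw0 hw' hwb hz hc hcd)
        (norm_nonneg _) (by positivity)
    _ = _ := by rw [div_eq_mul_inv]; ring

lemma setLIntegral_enorm_rpow_neg_half_lt_top {L : ℝ} (hL : 0 ≤ L) :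
    ∫⁻ v in Set.Icc (-L) L, ‖v‖ₑ ^ (-(1 / 2) : ℝ) < ∞ := by
  have h1 : IntervalIntegrable (fun v : ℝ => |v| ^ (-(1 / 2) : ℝ)) volume 0 L := by
    refine (intervalIntegral.intervalIntegrable_rpow' (r := -(1 / 2)) (by norm_num)).congr ?_
    intro v hv
    rw [Set.uIoc_of_le hL] at hv
    simp only [abs_of_pos hv.1]
  have h2 : IntervalIntegrable (fun v : ℝ => |v| ^ (-(1 / 2) : ℝ)) volume (-L) 0 := by
    have := ((IntervalIntegrable.iff_comp_neg).1 h1).symm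
    simpa using this
  have h3 := (intervalIntegrable_iff_integrableOn_Icc_of_le (by linarith)).1 (h2.trans h1)
  have h4 := h3.2
  rw [HasFiniteIntegral] at h4
  refine lt_of_eq_of_lt (lintegral_congr_ae ?_) h4
  filter_upwards [ae_restrict_of_ae (Measure.ae_ne volume (0 : ℝ))] with v hv
  rw [← ofReal_norm, ← ofReal_norm, Real.norm_eq_abs,
    ENNReal.ofReal_rpow_of_pos (abs_pos.2 hv), Real.norm_of_nonneg (by positivity)]

lemma lintegral_prod_enorm_sub_rpow_neg_half_lt_top {a b : ℝ} (hab : a ≤ b) :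
    ∫⁻ z, ‖z.1 - z.2‖ₑ ^ (-(1 / 2) : ℝ)
      ∂((volume.restrict (Set.Ioc a b)).prod (volume.restrict (Set.Ioc a b))) < ∞ := by
  set J := ∫⁻ v in Set.Icc (-(b - a)) (b - a), ‖v‖ₑ ^ (-(1 / 2) : ℝ) with hJ
  have hJt : J < ∞ := setLIntegral_enorm_rpow_neg_half_lt_top (sub_nonneg.2 hab)
  rw [lintegral_prod _ (by fun_prop)]
  have hin : ∀ s ∈ Set.Ioc a b,
      ∫⁻ s' in Set.Ioc a b, ‖s - s'‖ₑ ^ (-(1 / 2) : ℝ) ≤ J := fun s hs => by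
    rw [hJ, ← lintegral_indicator measurableSet_Ioc, ← lintegral_indicator measurableSet_Icc,
      ← lintegral_sub_left_eq_self ((Set.Icc (-(b - a)) (b - a)).indicator _) s]
    refine lintegral_mono fun s' => ?_
    by_cases hs' : s' ∈ Set.Ioc a b
    · have : s - s' ∈ Set.Icc (-(b - a)) (b - a) :=
        ⟨by linarith [hs.1, hs'.2], by linarith [hs.2, hs'.1]⟩
      rw [Set.indicator_of_mem hs', Set.indicator_of_mem this]
    · rw [Set.indicator_of_notMem hs']
      exact zero_le
  calc _ ≤ ∫⁻ _ in Set.Ioc a b, J := setLIntegral_mono measurable_const hin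
    _ < ∞ := by
      rw [setLIntegral_const]
      exact ENNReal.mul_lt_top hJt (by simp)

lemma setLIntegral_Ioi_le_of_forall_Ioc {h : ℝ → ℝ≥0∞} (hh : Measurable h) {a : ℝ} {K : ℝ≥0∞}
    (hK : ∀ b, a ≤ b → ∫⁻ l in Set.Ioc a b, h l ≤ K) : ∫⁻ l in Set.Ioi a, h l ≤ K := by
  have hcov : AECover (volume.restrict (Set.Ioi a)) Filter.atTop fun b : ℝ => Set.Iic b :=
    aecover_Iic Filter.tendsto_id
  refine le_of_tendsto (hcov.lintegral_tendsto_of_countably_generated hh.aemeasurable) ?_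
  filter_upwards [Filter.eventually_ge_atTop a] with b hb
  rw [Measure.restrict_restrict measurableSet_Iic, Set.inter_comm, Set.Ioi_inter_Iic]
  exact hK b hb

lemma hasDerivAt_sq_add_rpow_neg_quarter {κ : ℝ} (hκ : 0 < κ) (l : ℝ) :
    HasDerivAt (fun l : ℝ => (l ^ 2 + κ) ^ (-(1 / 4) : ℝ))
      (-(1 / 2) * l * (l ^ 2 + κ) ^ (-(5 / 4) : ℝ)) l := by
  refine (((hasDerivAt_pow 2 l).add_const κ).rpow_const (p := -(1 / 4))
    (Or.inl (by positivity))).congr_deriv ?_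
  rw [show (-(1 / 4) - 1 : ℝ) = -(5 / 4) by norm_num]
  push_cast
  ring

lemma sq_add_rpow_neg_quarter_le {κ l : ℝ} (hκ : 0 < κ) (hl : 0 < l) :
    (l ^ 2 + κ) ^ (-(1 / 4) : ℝ) ≤ 1 / √l := by
  calc (l ^ 2 + κ) ^ (-(1 / 4) : ℝ) ≤ (l ^ 2) ^ (-(1 / 4) : ℝ) :=
        Real.rpow_le_rpow_of_nonpos (by positivity) (by linarith) (by norm_num)
    _ = 1 / √l := by
      rw [← Real.rpow_natCast l 2, ← Real.rpow_mul hl.le, Real.sqrt_eq_rpow, one_div (l ^ _),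
        ← Real.rpow_neg hl.le]
      norm_num

lemma continuous_radialDensity (mv mz : ℕ) : Continuous (radialDensity mv mz) := by
  unfold radialDensity
  fun_prop

/-- **Finiteness of the integral `G₃` (far-range part `I₄`).**
Let `mv` be a positive even integer, `mz` a positive integer, `Q = mv/2 + mz`, `B > 2`,
`0 < R₀ < R`. There is `C > 0` (depending only on `mv`, `mz`, `B`, `R₀`, `R`) such that for
every measurable `t : (0,∞) → (0, 4/Q²)` and every measurable unimodular `ψ : [R₀,R] → ℂ`:
`∫_{B/R₀}^∞ (λ²+Q²/4)^{-1/4} |∫_{R₀}^R ψ(s) A(s)^{1/2} e^{i(λs + t(s)(λ²+Q²/4))} ds|² dλ ≤ C`. -/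
theorem G3_finiteness
    (mv mz : ℕ) (hmv : 0 < mv) (hmv_even : Even mv) (hmz : 0 < mz)
    (B R₀ R : ℝ) (hB : 2 < B) (hR₀ : 0 < R₀) (hR : R₀ < R) :
    ∃ C : ℝ, 0 < C ∧
      ∀ t : ℝ → ℝ, Measurable t →
        (∀ u : ℝ, 0 < u → t u ∈ Set.Ioo 0 (4 / homDim mv mz ^ 2)) →
      ∀ ψ : ℝ → ℂ, Measurable ψ → (∀ s ∈ Set.Icc R₀ R, ‖ψ s‖ = 1) →
      (∫⁻ l in Set.Ioi (B / R₀),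
          ENNReal.ofReal ((l ^ 2 + homDim mv mz ^ 2 / 4) ^ (-(1 / 4 : ℝ))) *
            (‖∫ s in R₀..R,
                ψ s * ((radialDensity mv mz s ^ ((1:ℝ)/2) : ℝ) : ℂ) *
                  Complex.exp (Complex.I *
                    ((l * s + t s * (l ^ 2 + homDim mv mz ^ 2 / 4) : ℝ) : ℂ))‖₊ : ℝ≥0∞) ^ 2)
        ≤ ENNReal.ofReal C := by
  set κ : ℝ := homDim mv mz ^ 2 / 4 with hκ
  have hκ0 : 0 < κ := by
    have : 0 < homDim mv mz := by unfold homDim; positivity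
    positivity
  set α : ℝ → ℝ := fun s => radialDensity mv mz s ^ ((1 : ℝ) / 2) with hα
  have hαc : Continuous α :=
    (continuous_radialDensity mv mz).rpow_const fun _ => Or.inr (by norm_num)
  obtain ⟨M, hM⟩ := isCompact_Icc.exists_bound_of_continuousOn (s := Set.Icc R₀ R) hαc.continuousOn
  have hM0 : 0 ≤ M := (norm_nonneg _).trans (hM R₀ (Set.left_mem_Icc.2 hR.le))
  set μ : Measure ℝ := volume.restrict (Set.Ioc R₀ R) with hμ
  set K : ℝ≥0∞ := ENNReal.ofReal (30 * M ^ 2) *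
    ∫⁻ z, ‖z.1 - z.2‖ₑ ^ (-(1 / 2) : ℝ) ∂(μ.prod μ) with hK
  have hKt : K ≠ ∞ :=
    (ENNReal.mul_lt_top ENNReal.ofReal_lt_top (lintegral_prod_enorm_sub_rpow_neg_half_lt_top hR.le)).ne
  refine ⟨K.toReal + 1, by positivity, fun t ht _ ψ hψ hψ1 => ?_⟩
  refine le_trans ?_ (ENNReal.ofReal_le_ofReal (le_add_of_nonneg_right zero_le_one))
  rw [ENNReal.ofReal_toReal hKt]
  set f : ℝ → ℂ := (Set.Ioc R₀ R).indicator fun s => ψ s * (α s : ℂ) with hf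
  have hfm : Measurable f := by
    refine Measurable.indicator ?_ measurableSet_Ioc
    fun_prop
  have hfM : ∀ s, ‖f s‖ ≤ M := fun s => by
    by_cases hs : s ∈ Set.Ioc R₀ R
    · have hs' := Set.Ioc_subset_Icc_self hs
      rw [hf, Set.indicator_of_mem hs, norm_mul, hψ1 s hs', one_mul, Complex.norm_real]
      exact hM s hs'
    · rwa [hf, Set.indicator_of_notMem hs, norm_zero]
  have hint : ∀ l : ℝ, ∫ s in R₀..R, ψ s * ((radialDensity mv mz s ^ ((1:ℝ)/2) : ℝ) : ℂ) *
        Complex.exp (Complex.I * ((l * s + t s * (l ^ 2 + κ) : ℝ) : ℂ)) =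
      ∫ s, f s * Complex.exp (Complex.I * ((l * s + t s * (l ^ 2 + κ) : ℝ) : ℂ)) ∂μ := fun l => by
    rw [intervalIntegral.integral_of_le hR.le]
    refine setIntegral_congr_fun measurableSet_Ioc fun s hs => ?_
    simp only [hf, hα, Set.indicator_of_mem hs]
  simp only [hint]
  have hF : Measurable fun l : ℝ =>
      ∫ s, f s * Complex.exp (Complex.I * ((l * s + t s * (l ^ 2 + κ) : ℝ) : ℂ)) ∂μ := by
    refine (StronglyMeasurable.integral_prod_right (f := fun l s => f s *
      Complex.exp (Complex.I * ((l * s + t s * (l ^ 2 + κ) : ℝ) : ℂ))) ?_).measurable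
    refine Measurable.stronglyMeasurable ?_
    simp only [Function.uncurry_def]
    fun_prop
  refine setLIntegral_Ioi_le_of_forall_Ioc (by fun_prop) fun b hb => ?_
  rw [hK, ← lintegral_const_mul _ (by fun_prop)]
  refine setLIntegral_mul_sq_le_lintegral_prod (hasDerivAt_sq_add_rpow_neg_quarter hκ0) ?_
    (fun l => by positivity) (fun l hl => ?_) (fun l => sq_add_rpow_neg_quarter_le hκ0)
    hfm hfM ht κ (by positivity) hb
  · exact (by fun_prop : Continuous fun l : ℝ => -(1 / 2) * l).mul
      ((by fun_prop : Continuous fun l : ℝ => l ^ 2 + κ).rpow_const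
        fun l => Or.inl (by positivity))
  · have : 0 ≤ l * (l ^ 2 + κ) ^ (-(5 / 4) : ℝ) := by positivity
    linarith
end

section
/- For every R > 0 there exists a constant c > 0 such that for every even Schwartz function F : ℝ → ℂ: ∫_0^R sup_{0 < t < 1} | ∫_0^∞ (sin(λ s)/(λ sinh s)) e^{i t (λ² + 1)} F(λ) λ² dλ | sinh²(s) ds ≤ c ( ∫_0^∞ (λ² + 1)^{1/4} |F(λ)|² λ² dλ )^{1/2}. -/
open MeasureTheory
open scoped ENNReal NNReal SchwartzMap

/-- The unimodular wave with phase `x μ² + t μ⁴`. -/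
noncomputable def quarticWave (x t μ : ℝ) : ℂ :=
  Complex.exp (Complex.I * ((x * μ ^ 2 + t * μ ^ 4 : ℝ) : ℂ))

lemma norm_quarticWave (x t μ : ℝ) : ‖quarticWave x t μ‖ = 1 := by
  rw [quarticWave, mul_comm, Complex.norm_exp_ofReal_mul_I]

lemma continuous_quarticWave :
    Continuous fun p : ℝ × ℝ × ℝ => quarticWave p.1 p.2.1 p.2.2 := by
  unfold quarticWave
  fun_prop

lemma continuous_quarticWave_apply (x t : ℝ) : Continuous (quarticWave x t) :=
  continuous_quarticWave.comp (by fun_prop : Continuous fun μ : ℝ => (x, t, μ))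

lemma star_quarticWave (x t μ : ℝ) :
    (starRingEnd ℂ) (quarticWave x t μ) = quarticWave (-x) (-t) μ := by
  rw [quarticWave, quarticWave, ← Complex.exp_conj]
  congr 1
  simp only [map_mul, Complex.conj_I, Complex.conj_ofReal]
  push_cast
  ring

lemma quarticWave_mul (x t y u μ : ℝ) :
    quarticWave x t μ * quarticWave y u μ = quarticWave (x + y) (t + u) μ := by
  rw [quarticWave, quarticWave, quarticWave, ← Complex.exp_add]
  congr 1
  push_cast
  ring

/-- The derivative of `μ² + t μ⁴` vanishes at most linearly on the half-line. -/
lemma exists_one_div_one_add_sq_le (t : ℝ) : ∃ r : ℝ, ∀ μ : ℝ, 0 ≤ μ →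
    1 / (1 + (2 * μ + 4 * t * μ ^ 3) ^ 2) ≤ (1 + μ ^ 2)⁻¹ + (1 + (μ - r) ^ 2)⁻¹ := by
  have key : ∀ y z : ℝ, z ^ 2 ≤ y ^ 2 → 1 / (1 + y ^ 2) ≤ (1 + z ^ 2)⁻¹ := by
    intro y z h
    rw [one_div]
    exact inv_anti₀ (by positivity) (by linarith)
  have pos : ∀ z : ℝ, 0 ≤ (1 + z ^ 2)⁻¹ := fun z => by positivity
  rcases le_or_gt 0 t with ht | ht
  · refine ⟨0, fun μ hμ => ?_⟩
    have := key (2 * μ + 4 * t * μ ^ 3) μ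
      (pow_le_pow_left₀ hμ (by nlinarith [mul_nonneg ht (pow_nonneg hμ 3)]) 2)
    linarith [pos (μ - 0)]
  · obtain ⟨r, hr, hrt⟩ : ∃ r : ℝ, 0 < r ∧ 2 * t * r ^ 2 = -1 := by
      refine ⟨Real.sqrt (1 / (-(2 * t))), Real.sqrt_pos.2 (by
        apply one_div_pos.2; linarith), ?_⟩
      rw [Real.sq_sqrt (one_div_nonneg.2 (by linarith))]
      have := ht.ne
      field_simp
    refine ⟨r, fun μ hμ => ?_⟩
    have hφ : 2 * μ + 4 * t * μ ^ 3 = 2 * (μ / r) * (1 + μ / r) * (r - μ) := by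
      have ht' : t = -1 / (2 * r ^ 2) := by
        field_simp
        linarith
      rw [ht']
      field_simp
      ring
    rcases le_or_gt μ (r / 2) with h | h
    · have h1 : μ ≤ 2 * μ + 4 * t * μ ^ 3 := by
        have : μ * (2 * t * r ^ 2 - 2 * t * (4 * μ ^ 2)) ≤ 0 := by
          have h2 : 4 * μ ^ 2 ≤ r ^ 2 := by nlinarith
          nlinarith [mul_nonneg hμ (mul_nonneg (neg_nonneg.2 ht.le) (sub_nonneg.2 h2))]
        nlinarith
      have := key _ μ (pow_le_pow_left₀ hμ h1 2)
      linarith [pos (μ - r)]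
    · have h1 : 1 ≤ 2 * (μ / r) * (1 + μ / r) := by
        have : 1 / 2 ≤ μ / r := by
          rw [le_div_iff₀ hr]
          linarith
        nlinarith
      have := key (2 * μ + 4 * t * μ ^ 3) (μ - r) (by
        rw [hφ, mul_pow, show (r - μ) ^ 2 = (μ - r) ^ 2 by ring]
        exact le_mul_of_one_le_left (sq_nonneg _) (one_le_pow₀ h1))
      linarith [pos μ]

lemma integral_inv_one_add_sub_sq_le (r : ℝ) {M : ℝ} :
    ∫ μ in (0:ℝ)..M, (1 + (μ - r) ^ 2)⁻¹ ≤ Real.pi := by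
  rw [intervalIntegral.integral_comp_sub_right (fun μ : ℝ => (1 + μ ^ 2)⁻¹) r,
    integral_inv_one_add_sq]
  linarith [Real.arctan_lt_pi_div_two (M - r), Real.neg_pi_div_two_lt_arctan (0 - r)]

/-- A van der Corput type bound, uniform in `t` and `M`. -/
lemma norm_integral_quarticWave_one_le (t : ℝ) {M : ℝ} (hM : 0 ≤ M) :
    ‖∫ μ in (0:ℝ)..M, quarticWave 1 t μ‖ ≤ 40 := by
  set d : ℝ → ℝ := fun μ => 2 * μ + 4 * t * μ ^ 3 with hd
  set d' : ℝ → ℝ := fun μ => 2 + 12 * t * μ ^ 2 with hd'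
  have hdc : Continuous d := by fun_prop
  have hdc' : Continuous d' := by fun_prop
  have hpos : ∀ μ, 0 < 1 + d μ ^ 2 := fun μ => by positivity
  have hderiv : ∀ μ, HasDerivAt d (d' μ) μ := fun μ => by
    have := ((hasDerivAt_id' μ).const_mul 2).add ((hasDerivAt_pow 3 μ).const_mul (4 * t))
    refine this.congr_deriv ?_
    simp only [hd']
    push_cast
    ring
  have hwave : ∀ μ, HasDerivAt (quarticWave 1 t) (quarticWave 1 t μ * (Complex.I * (d μ : ℂ))) μ := by
    intro μ
    have h : HasDerivAt (fun μ : ℝ => 1 * μ ^ 2 + t * μ ^ 4) (d μ) μ := by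
      have := ((hasDerivAt_pow 2 μ).const_mul 1).add ((hasDerivAt_pow 4 μ).const_mul t)
      refine this.congr_deriv ?_
      simp only [hd]
      push_cast
      ring
    exact (h.ofReal_comp.const_mul Complex.I).cexp
  set p : ℝ → ℝ := fun μ => d μ / (1 + d μ ^ 2) with hp
  set p' : ℝ → ℝ := fun μ => d' μ * (1 - d μ ^ 2) / (1 + d μ ^ 2) ^ 2 with hp'
  have hpd : ∀ μ, HasDerivAt p (p' μ) μ := fun μ => by
    have := (hderiv μ).div (((hderiv μ).pow 2).const_add 1) (hpos μ).ne'
    refine this.congr_deriv ?_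
    simp only [hp', Pi.pow_apply]
    push_cast
    ring
  have hwc := continuous_quarticWave_apply 1 t
  have hpc : Continuous p := hdc.div (by fun_prop) fun μ => (hpos μ).ne'
  have hpc' : Continuous p' :=
    (by fun_prop : Continuous fun μ => d' μ * (1 - d μ ^ 2)).div (by fun_prop)
      fun μ => (pow_pos (hpos μ) 2).ne'
  have hic : Continuous fun μ => 1 / (1 + d μ ^ 2) :=
    continuous_const.div (by fun_prop) fun μ => (hpos μ).ne'
  set D : ℝ → ℂ := fun μ => quarticWave 1 t μ * (Complex.I * (d μ : ℂ)) * (p μ : ℂ)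
    + quarticWave 1 t μ * (p' μ : ℂ) with hD
  have hDc : Continuous D := by fun_prop
  have hFTC : ∫ μ in (0:ℝ)..M, D μ
      = quarticWave 1 t M * (p M : ℂ) - quarticWave 1 t 0 * (p 0 : ℂ) :=
    intervalIntegral.integral_eq_sub_of_hasDerivAt
      (fun μ _ => (hwave μ).mul (hpd μ).ofReal_comp) (hDc.intervalIntegrable _ _)
  set E : ℝ → ℂ := fun μ => quarticWave 1 t μ * (((1 / (1 + d μ ^ 2) : ℝ) : ℂ)
    + Complex.I * (p' μ : ℂ)) with hE
  have hEc : Continuous E := by fun_prop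
  have hsplit : ∀ μ, quarticWave 1 t μ = -Complex.I * D μ + E μ := by
    intro μ
    have h1 : ((d μ * p μ : ℝ) : ℂ) + ((1 / (1 + d μ ^ 2) : ℝ) : ℂ) = 1 := by
      rw [← Complex.ofReal_add, ← Complex.ofReal_one]
      congr 1
      have := (hpos μ).ne'
      simp only [hp]
      field_simp
      ring
    push_cast at h1
    simp only [hD, hE]
    push_cast
    linear_combination (-quarticWave 1 t μ) * h1
      + quarticWave 1 t μ * d μ * p μ * Complex.I_sq
  have hpb : ∀ μ, |p μ| ≤ 1 := by
    intro μ
    rw [hp]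
    simp only
    rw [abs_div, abs_of_pos (hpos μ), div_le_one (hpos μ), abs_le]
    constructor <;> nlinarith [sq_nonneg (d μ - 1), sq_nonneg (d μ + 1)]
  obtain ⟨r, hr⟩ := exists_one_div_one_add_sq_le t
  obtain ⟨σ, hσ, hσd⟩ : ∃ σ : ℝ, |σ| ≤ 1 ∧ ∀ μ, |d' μ| ≤ 4 + σ * d' μ := by
    rcases le_or_gt 0 t with ht | ht
    · refine ⟨1, by norm_num, fun μ => ?_⟩
      have : 0 ≤ d' μ := by simp only [hd']; positivity
      rw [abs_of_nonneg this]
      linarith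
    · refine ⟨-1, by norm_num, fun μ => ?_⟩
      have : d' μ ≤ 2 := by
        simp only [hd']
        nlinarith [mul_nonneg (neg_nonneg.2 ht.le) (sq_nonneg μ)]
      rw [abs_le]
      constructor <;> linarith
  have hEb : ∀ μ ∈ Set.Icc 0 M, ‖E μ‖ ≤ 5 * ((1 + μ ^ 2)⁻¹ + (1 + (μ - r) ^ 2)⁻¹)
      + σ * (1 / (1 + d μ ^ 2) * d' μ) := by
    intro μ hμ
    have hq := hpos μ
    have hp1 : |p' μ| ≤ |d' μ| * (1 / (1 + d μ ^ 2)) := by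
      simp only [hp']
      rw [abs_div, abs_mul, abs_of_pos (pow_pos hq 2), mul_div_assoc]
      refine mul_le_mul_of_nonneg_left ?_ (abs_nonneg _)
      rw [div_le_div_iff₀ (pow_pos hq 2) hq, one_mul, sq (1 + d μ ^ 2)]
      refine mul_le_mul_of_nonneg_right ?_ hq.le
      rw [abs_le]
      constructor <;> nlinarith [sq_nonneg (d μ)]
    have h2 : ‖E μ‖ ≤ 1 / (1 + d μ ^ 2) + |p' μ| := by
      simp only [hE]
      rw [norm_mul, norm_quarticWave, one_mul]
      refine (norm_add_le _ _).trans ?_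
      rw [norm_mul, Complex.norm_I, one_mul, Complex.norm_real, Complex.norm_real,
        Real.norm_eq_abs, Real.norm_eq_abs, abs_of_pos (one_div_pos.2 hq)]
    have h3 := mul_le_mul_of_nonneg_right (hσd μ) (one_div_pos.2 hq).le
    have h4 := hr μ hμ.1
    change 1 / (1 + d μ ^ 2) ≤ _ at h4
    nlinarith
  have hc1 : ∀ r : ℝ, Continuous fun μ : ℝ => (1 + (μ - r) ^ 2)⁻¹ := fun r =>
    Continuous.inv₀ (by fun_prop) fun μ => by positivity
  have hc0 : Continuous fun μ : ℝ => (1 + μ ^ 2)⁻¹ := by simpa using hc1 0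
  have hEint : ‖∫ μ in (0:ℝ)..M, E μ‖ ≤ 11 * Real.pi := by
    refine (intervalIntegral.norm_integral_le_of_norm_le hM
      (Filter.Eventually.of_forall fun μ hμ => hEb μ ⟨hμ.1.le, hμ.2⟩)
      (Continuous.intervalIntegrable (by have := hc1 r; fun_prop) _ _)).trans ?_
    have hat : ∫ μ in (0:ℝ)..M, 1 / (1 + d μ ^ 2) * d' μ
        = Real.arctan (d M) - Real.arctan (d 0) :=
      intervalIntegral.integral_eq_sub_of_hasDerivAt (fun μ _ => (hderiv μ).arctan)
        ((hic.mul hdc').intervalIntegrable _ _)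
    have h1 := hc1 r
    rw [intervalIntegral.integral_add
      (Continuous.intervalIntegrable (by fun_prop) _ _)
      (Continuous.intervalIntegrable (by fun_prop) _ _),
      intervalIntegral.integral_const_mul, intervalIntegral.integral_const_mul,
      intervalIntegral.integral_add (hc0.intervalIntegrable _ _)
      (h1.intervalIntegrable _ _), hat]
    have i1 := integral_inv_one_add_sub_sq_le r (M := M)
    have i2 := integral_inv_one_add_sub_sq_le 0 (M := M)
    simp only [sub_zero] at i2
    have i3 : σ * (Real.arctan (d M) - Real.arctan (d 0)) ≤ Real.pi := by
      refine (le_abs_self _).trans ?_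
      rw [abs_mul]
      have : |Real.arctan (d M) - Real.arctan (d 0)| ≤ Real.pi := by
        rw [abs_le]
        constructor <;> linarith [Real.arctan_lt_pi_div_two (d M),
          Real.neg_pi_div_two_lt_arctan (d M), Real.arctan_lt_pi_div_two (d 0),
          Real.neg_pi_div_two_lt_arctan (d 0)]
      nlinarith [abs_nonneg σ, abs_nonneg (Real.arctan (d M) - Real.arctan (d 0))]
    linarith
  have hbd : ∀ μ, ‖quarticWave 1 t μ * (p μ : ℂ)‖ ≤ 1 := fun μ => by
    rw [norm_mul, norm_quarticWave, one_mul, Complex.norm_real]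
    exact hpb μ
  calc ‖∫ μ in (0:ℝ)..M, quarticWave 1 t μ‖
      = ‖-Complex.I * (quarticWave 1 t M * (p M : ℂ) - quarticWave 1 t 0 * (p 0 : ℂ))
          + ∫ μ in (0:ℝ)..M, E μ‖ := by
        rw [← hFTC, ← intervalIntegral.integral_const_mul, ← intervalIntegral.integral_add
          (Continuous.intervalIntegrable (by fun_prop) _ _) (hEc.intervalIntegrable _ _)]
        simp_rw [← hsplit]
    _ ≤ (1 + 1) + 11 * Real.pi := by
        refine (norm_add_le _ _).trans (add_le_add ?_ hEint)
        rw [norm_mul, norm_neg, Complex.norm_I, one_mul]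
        exact (norm_sub_le _ _).trans (add_le_add (hbd M) (hbd 0))
    _ ≤ 40 := by linarith [Real.pi_lt_d2]

lemma norm_integral_quarticWave_le {x : ℝ} (hx : x ≠ 0) (t : ℝ) {M : ℝ} (hM : 0 ≤ M) :
    ‖∫ μ in (0:ℝ)..M, quarticWave x t μ‖ ≤ 40 * |x| ^ (-(1 / 2) : ℝ) := by
  have pos : ∀ x t : ℝ, 0 < x →
      ‖∫ μ in (0:ℝ)..M, quarticWave x t μ‖ ≤ 40 * x ^ (-(1 / 2) : ℝ) := by
    intro x t hx
    have hs : 0 < Real.sqrt x := Real.sqrt_pos.2 hx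
    have h : ∀ μ, quarticWave x t μ = quarticWave 1 (t / x ^ 2) (Real.sqrt x * μ) := by
      intro μ
      unfold quarticWave
      rw [mul_pow, mul_pow, show Real.sqrt x ^ 4 = (Real.sqrt x ^ 2) ^ 2 by ring,
        Real.sq_sqrt hx.le]
      have : t / x ^ 2 * (x ^ 2 * μ ^ 4) = t * μ ^ 4 := by field_simp
      rw [this, one_mul]
    simp_rw [h]
    rw [intervalIntegral.integral_comp_mul_left _ hs.ne', mul_zero, norm_smul, norm_inv,
      Real.norm_of_nonneg hs.le, Real.rpow_neg hx.le, ← Real.sqrt_eq_rpow, mul_comm]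
    gcongr
    exact norm_integral_quarticWave_one_le _ (by positivity)
  rcases lt_or_gt_of_ne hx with h | h
  · rw [abs_of_neg h]
    have := pos (-x) (-t) (by linarith)
    simp_rw [← star_quarticWave] at this
    rwa [intervalIntegral.intervalIntegral_conj, RCLike.norm_conj] at this
  · rw [abs_of_pos h]
    exact pos x t h

lemma intervalIntegrable_abs_rpow (R : ℝ) (hR : 0 ≤ R) :
    IntervalIntegrable (fun y : ℝ => |y| ^ (-(1 / 2) : ℝ)) volume (-R) R := by
  have h : IntervalIntegrable (fun y : ℝ => |y| ^ (-(1 / 2) : ℝ)) volume 0 R := by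
    refine (intervalIntegral.intervalIntegrable_rpow' (r := (-(1 / 2) : ℝ))
      (by norm_num)).congr fun y hy => ?_
    rw [Set.uIoc_of_le hR] at hy
    simp only [abs_of_pos hy.1]
  refine IntervalIntegrable.trans (b := 0) ?_ h
  have := (IntervalIntegrable.comp_sub_left h 0).symm
  simpa using this

lemma integral_abs_sub_rpow_le {R s : ℝ} (hs : s ∈ Set.Ioc 0 R) :
    IntegrableOn (fun s' : ℝ => |s - s'| ^ (-(1 / 2) : ℝ)) (Set.Ioc 0 R) ∧
      ∫ s' in Set.Ioc 0 R, |s - s'| ^ (-(1 / 2) : ℝ)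
        ≤ ∫ y in (-R)..R, |y| ^ (-(1 / 2) : ℝ) := by
  have hR : 0 ≤ R := hs.1.le.trans hs.2
  have hI := intervalIntegrable_abs_rpow R hR
  have hsub : IntervalIntegrable (fun y : ℝ => |y| ^ (-(1 / 2) : ℝ)) volume (s - R) s := by
    refine hI.mono_set ?_
    rw [Set.uIcc_of_le (by linarith), Set.uIcc_of_le (by linarith)]
    exact Set.Icc_subset_Icc (by linarith [hs.1]) hs.2
  constructor
  · have := (IntervalIntegrable.comp_sub_left hsub s).symm
    simp only [sub_sub_cancel, sub_self] at this
    exact (intervalIntegrable_iff_integrableOn_Ioc_of_le hR).1 this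
  · rw [← intervalIntegral.integral_of_le hR,
      intervalIntegral.integral_comp_sub_left (fun y : ℝ => |y| ^ (-(1 / 2) : ℝ)) s, sub_zero]
    exact intervalIntegral.integral_mono_interval (by linarith [hs.1]) (by linarith) hs.2
      (Filter.Eventually.of_forall fun y => by positivity) hI

/-- Boundedness of the adjoint of the linearized maximal operator. -/
lemma integral_norm_sq_integral_quarticWave_le {R ε M : ℝ} (hR : 0 < R) (hε : |ε| = 1)
    (hM : 0 ≤ M) {τ : ℝ → ℝ} (hτ : Measurable τ) {w : ℝ → ℂ} (hw : Measurable w)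
    (hw1 : ∀ s, ‖w s‖ ≤ 1) :
    ∫ μ in (0:ℝ)..M, ‖∫ s in Set.Ioc 0 R, w s * quarticWave (ε * s) (τ s) μ‖ ^ 2
      ≤ 40 * (∫ y in (-R)..R, |y| ^ (-(1 / 2) : ℝ)) * R := by
  set a : ℝ → ℝ → ℂ := fun s μ => w s * quarticWave (ε * s) (τ s) μ with ha
  have ham : Measurable (Function.uncurry a) := by
    have : Measurable fun p : ℝ × ℝ => quarticWave (ε * p.1) (τ p.1) p.2 :=
      continuous_quarticWave.measurable.comp
      (by fun_prop : Measurable fun p : ℝ × ℝ => (ε * p.1, τ p.1, p.2))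
    exact (hw.comp measurable_fst).mul this
  have ha1 : ∀ s μ, ‖a s μ‖ ≤ 1 := fun s μ => by
    simp only [ha]
    rw [norm_mul, norm_quarticWave, mul_one]
    exact hw1 s
  set S : ℝ → ℂ := fun μ => ∫ s in Set.Ioc 0 R, a s μ with hS
  have hSm : Measurable S := ham.stronglyMeasurable.integral_prod_left.measurable
  have hvol : (volume.restrict (Set.Ioc (0:ℝ) R)).real Set.univ = R := by
    simp [hR.le]
  have hS1 : ∀ μ, ‖S μ‖ ≤ R := fun μ => by
    have := norm_integral_le_of_norm_le_const (μ := volume.restrict (Set.Ioc 0 R))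
      (Filter.Eventually.of_forall fun s => ha1 s μ)
    rwa [hvol, one_mul] at this
  have hfin : IsFiniteMeasure (volume.restrict (Set.uIoc 0 M)) := by
    rw [Set.uIoc_of_le hM]
    infer_instance
  have inner : ∀ s ∈ Set.Ioc 0 R, ‖∫ μ in (0:ℝ)..M, a s μ * (starRingEnd ℂ) (S μ)‖
      ≤ 40 * ∫ y in (-R)..R, |y| ^ (-(1 / 2) : ℝ) := by
    intro s hs
    have h1 : ∀ μ, a s μ * (starRingEnd ℂ) (S μ)
        = ∫ s' in Set.Ioc 0 R, a s μ * (starRingEnd ℂ) (a s' μ) := fun μ => by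
      rw [integral_const_mul, integral_conj]
    simp_rw [h1]
    rw [intervalIntegral_integral_swap]
    · obtain ⟨hi, hle⟩ := integral_abs_sub_rpow_le hs
      refine (norm_integral_le_of_norm_le (hi.const_mul 40) ?_).trans ?_
      · have hne : ∀ᵐ s' ∂(volume.restrict (Set.Ioc 0 R)), s' ≠ s :=
          ae_restrict_of_ae (Measure.ae_ne volume s)
        filter_upwards [hne] with s' hs'
        have h2 : ∀ μ, a s μ * (starRingEnd ℂ) (a s' μ) = w s * (starRingEnd ℂ) (w s')
            * quarticWave (ε * (s - s')) (τ s - τ s') μ := fun μ => by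
          simp only [ha, map_mul, star_quarticWave]
          rw [show ε * (s - s') = ε * s + -(ε * s') by ring, sub_eq_add_neg,
            ← quarticWave_mul]
          ring
        simp_rw [h2]
        have hx : ε * (s - s') ≠ 0 :=
          mul_ne_zero (by rintro rfl; simp at hε) (sub_ne_zero.2 hs'.symm)
        have h3 := norm_integral_quarticWave_le hx (τ s - τ s') hM
        rw [abs_mul, hε, one_mul] at h3
        rw [intervalIntegral.integral_const_mul, norm_mul, norm_mul, RCLike.norm_conj]
        have h4 : ‖w s‖ * ‖w s'‖ ≤ 1 :=
          mul_le_one₀ (hw1 s) (norm_nonneg _) (hw1 s')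
        exact (mul_le_of_le_one_left (norm_nonneg _) h4).trans h3
      · rw [integral_const_mul]
        gcongr
    · refine Integrable.of_bound (C := 1) (Measurable.aestronglyMeasurable ?_)
        (Filter.Eventually.of_forall fun p => ?_)
      · have m1 : Measurable fun p : ℝ × ℝ => a s p.1 :=
          ham.comp (measurable_const.prodMk measurable_fst)
        have m2 : Measurable fun p : ℝ × ℝ => (starRingEnd ℂ) (a p.2 p.1) :=
          Complex.continuous_conj.measurable.comp (ham.comp measurable_swap)
        exact m1.mul m2
      · simp only [Function.uncurry]
        rw [norm_mul, RCLike.norm_conj]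
        exact mul_le_one₀ (ha1 _ _) (norm_nonneg _) (ha1 _ _)
  have hsq : ((∫ μ in (0:ℝ)..M, ‖S μ‖ ^ 2 : ℝ) : ℂ)
      = ∫ s in Set.Ioc 0 R, ∫ μ in (0:ℝ)..M, a s μ * (starRingEnd ℂ) (S μ) := by
    rw [← intervalIntegral.integral_ofReal, ← intervalIntegral_integral_swap]
    · refine intervalIntegral.integral_congr fun μ _ => ?_
      rw [integral_mul_const, RCLike.mul_conj]
      push_cast
      rfl
    · refine Integrable.of_bound (C := 1 * R) (Measurable.aestronglyMeasurable ?_)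
        (Filter.Eventually.of_forall fun p => ?_)
      · exact (ham.comp measurable_swap).mul
          (Complex.continuous_conj.measurable.comp (hSm.comp measurable_fst))
      · simp only [Function.uncurry]
        rw [norm_mul, RCLike.norm_conj]
        exact mul_le_mul (ha1 _ _) (hS1 _) (norm_nonneg _) zero_le_one
  have hnn : 0 ≤ ∫ μ in (0:ℝ)..M, ‖S μ‖ ^ 2 :=
    intervalIntegral.integral_nonneg hM fun μ _ => by positivity
  rw [← Real.norm_of_nonneg hnn, ← Complex.norm_real, hsq]
  refine (norm_integral_le_of_norm_le_const
    ((ae_restrict_iff' measurableSet_Ioc).2 (Filter.Eventually.of_forall inner))).trans ?_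
  rw [hvol]

/-- The linearized maximal inequality. -/
lemma integral_norm_integral_quarticWave_mul_le {R ε : ℝ} (hR : 0 < R) (hε : |ε| = 1)
    {τ : ℝ → ℝ} (hτ : Measurable τ) {G : ℝ → ℂ} (hGc : Continuous G)
    (hG : IntegrableOn G (Set.Ioi 0)) (hG2 : IntegrableOn (fun μ => ‖G μ‖ ^ 2) (Set.Ioi 0)) :
    ∫ s in Set.Ioc 0 R, ‖∫ μ in Set.Ioi (0:ℝ), quarticWave (ε * s) (τ s) μ * G μ‖
      ≤ Real.sqrt (40 * (∫ y in (-R)..R, |y| ^ (-(1 / 2) : ℝ)) * R)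
        * Real.sqrt (∫ μ in Set.Ioi (0:ℝ), ‖G μ‖ ^ 2) := by
  have hem : Measurable fun p : ℝ × ℝ => quarticWave (ε * p.1) (τ p.1) p.2 :=
    continuous_quarticWave.measurable.comp
      (by fun_prop : Measurable fun p : ℝ × ℝ => (ε * p.1, τ p.1, p.2))
  set T : ℝ → ℂ := fun s => ∫ μ in Set.Ioi (0:ℝ), quarticWave (ε * s) (τ s) μ * G μ with hT
  have hTm : Measurable T := by
    have : Measurable (Function.uncurry fun s μ => quarticWave (ε * s) (τ s) μ * G μ) :=
      hem.mul (hGc.measurable.comp measurable_snd)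
    exact this.stronglyMeasurable.integral_prod_right.measurable
  set w : ℝ → ℂ := fun s => (starRingEnd ℂ) (T s) / (‖T s‖ : ℂ) with hw
  have hwm : Measurable w :=
    (Complex.continuous_conj.measurable.comp hTm).div
      (Complex.measurable_ofReal.comp hTm.norm)
  have hw1 : ∀ s, ‖w s‖ ≤ 1 := fun s => by
    simp only [hw]
    rw [norm_div, RCLike.norm_conj, Complex.norm_real, norm_norm]
    exact div_self_le_one _
  have hwT : ∀ s, w s * T s = (‖T s‖ : ℂ) := fun s => by
    by_cases h : T s = 0
    · simp [h]
    · have : (‖T s‖ : ℂ) ≠ 0 := by simpa using h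
      simp only [hw]
      rw [div_mul_eq_mul_div, RCLike.conj_mul, div_eq_iff this, sq]
      rfl
  set a : ℝ → ℝ → ℂ := fun s μ => w s * quarticWave (ε * s) (τ s) μ with ha
  have ham : Measurable (Function.uncurry a) := (hwm.comp measurable_fst).mul hem
  have ha1 : ∀ s μ, ‖a s μ‖ ≤ 1 := fun s μ => by
    simp only [ha]
    rw [norm_mul, norm_quarticWave, mul_one]
    exact hw1 s
  set S : ℝ → ℂ := fun μ => ∫ s in Set.Ioc 0 R, a s μ with hS
  have hSm : Measurable S := ham.stronglyMeasurable.integral_prod_left.measurable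
  have hvol : (volume.restrict (Set.Ioc (0:ℝ) R)).real Set.univ = R := by
    simp [hR.le]
  have hS1 : ∀ μ, ‖S μ‖ ≤ R := fun μ => by
    have := norm_integral_le_of_norm_le_const (μ := volume.restrict (Set.Ioc 0 R))
      (Filter.Eventually.of_forall fun s => ha1 s μ)
    rwa [hvol, one_mul] at this
  have hdual : ((∫ s in Set.Ioc 0 R, ‖T s‖ : ℝ) : ℂ)
      = ∫ μ in Set.Ioi (0:ℝ), S μ * G μ := by
    rw [← integral_complex_ofReal]
    have h1 : ∀ s, ((‖T s‖ : ℝ) : ℂ) = ∫ μ in Set.Ioi (0:ℝ), a s μ * G μ := fun s => by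
      rw [← hwT, hT, ← integral_const_mul]
      simp only [ha, mul_assoc]
    have h2 : ∀ μ, S μ * G μ = ∫ s in Set.Ioc 0 R, a s μ * G μ := fun μ => by
      rw [integral_mul_const]
    simp_rw [h2]
    refine (integral_congr_ae (Filter.Eventually.of_forall h1)).trans
      (integral_integral_swap ?_)
    have hGp : Integrable (fun p : ℝ × ℝ => G p.2)
        ((volume.restrict (Set.Ioc 0 R)).prod (volume.restrict (Set.Ioi 0))) :=
      Integrable.comp_snd hG _
    exact hGp.bdd_mul ham.aestronglyMeasurable
      (Filter.Eventually.of_forall fun p => ha1 p.1 p.2)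
  have hSG : IntegrableOn (fun μ => S μ * G μ) (Set.Ioi 0) :=
    Integrable.bdd_mul hG hSm.aestronglyMeasurable (Filter.Eventually.of_forall hS1)
  have hlim := (intervalIntegral_tendsto_integral_Ioi 0 hSG Filter.tendsto_id).norm
  rw [← hdual, Complex.norm_real, Real.norm_of_nonneg
    (integral_nonneg fun s => norm_nonneg _)] at hlim
  refine le_of_tendsto hlim ?_
  filter_upwards [Filter.eventually_ge_atTop 0] with M hM
  have hSL2 := integral_norm_sq_integral_quarticWave_le hR hε hM hτ hwm hw1
  change ∫ μ in (0:ℝ)..M, ‖S μ‖ ^ 2 ≤ _ at hSL2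
  simp only [id]
  rw [intervalIntegral.integral_of_le hM] at hSL2 ⊢
  have hsub : Set.Ioc 0 M ⊆ Set.Ioi (0:ℝ) := Set.Ioc_subset_Ioi_self
  have hmS : MemLp S (ENNReal.ofReal 2) (volume.restrict (Set.Ioc 0 M)) :=
    MemLp.of_bound hSm.aestronglyMeasurable R (Filter.Eventually.of_forall hS1)
  have hmG : MemLp G (ENNReal.ofReal 2) (volume.restrict (Set.Ioc 0 M)) := by
    rw [show ENNReal.ofReal 2 = 2 by simp]
    exact (memLp_two_iff_integrable_sq_norm hGc.aestronglyMeasurable).2 (hG2.mono_set hsub)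
  have hCS := integral_mul_norm_le_Lp_mul_Lq (μ := volume.restrict (Set.Ioc 0 M))
    Real.HolderConjugate.two_two hmS hmG
  refine (norm_integral_le_integral_norm _).trans ?_
  simp only [norm_mul]
  refine hCS.trans ?_
  rw [← Real.sqrt_eq_rpow, ← Real.sqrt_eq_rpow]
  simp only [Real.rpow_two]
  gcongr
  exact Filter.Eventually.of_forall fun μ => by positivity

lemma exists_measurable_norm_le_two_mul {V : ℝ → ℝ → ℂ} (hV : Continuous (Function.uncurry V))
    {B : ℝ} (hB : ∀ s t, ‖V s t‖ ≤ B) :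
    ∃ τ : ℝ → ℝ, Measurable τ ∧ ∀ s t, ‖V s t‖ ≤ 2 * ‖V s (τ s)‖ := by
  classical
  have hex : ∀ s, ∃ k : ℕ, ∀ t, ‖V s t‖ ≤ 2 * ‖V s (TopologicalSpace.denseSeq ℝ k)‖ := by
    intro s
    have hbdd : BddAbove (Set.range fun t => ‖V s t‖) := ⟨B, by rintro _ ⟨t, rfl⟩; exact hB s t⟩
    by_cases h : ∀ t, V s t = 0
    · exact ⟨0, fun t => by simp [h]⟩
    · push Not at h
      obtain ⟨t₀, ht₀⟩ := h
      have hM : 0 < ⨆ t, ‖V s t‖ := (norm_pos_iff.2 ht₀).trans_le (le_ciSup hbdd t₀)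
      obtain ⟨t₁, ht₁⟩ := exists_lt_of_lt_ciSup (half_lt_self hM)
      have hVs : Continuous (V s) := hV.comp (by fun_prop : Continuous fun t : ℝ => (s, t))
      obtain ⟨k, hmem⟩ := (TopologicalSpace.denseRange_denseSeq ℝ).exists_mem_open
        (isOpen_lt continuous_const hVs.norm) ⟨t₁, ht₁⟩
      refine ⟨k, fun t => (le_ciSup hbdd t).trans ?_⟩
      have : (⨆ t, ‖V s t‖) / 2 < ‖V s (TopologicalSpace.denseSeq ℝ k)‖ := hmem
      linarith
  refine ⟨fun s => TopologicalSpace.denseSeq ℝ (Nat.find (hex s)),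
    (measurable_from_nat).comp (measurable_find hex fun k => ?_),
    fun s => Nat.find_spec (hex s)⟩
  rw [Set.ofPred_forall]
  refine (isClosed_iInter fun t => ?_).measurableSet
  exact isClosed_le (hV.comp (by fun_prop : Continuous fun s : ℝ => (s, t))).norm
    (continuous_const.mul (hV.comp (by fun_prop : Continuous fun s : ℝ =>
      (s, TopologicalSpace.denseSeq ℝ k))).norm)

lemma integral_Ioi_eq_integral_comp_sq {E : Type*} [NormedAddCommGroup E] [NormedSpace ℝ E]
    (g : ℝ → E) :
    ∫ l in Set.Ioi (0:ℝ), g l = ∫ μ in Set.Ioi (0:ℝ), (2 * μ) • g (μ ^ 2) := by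
  rw [← integral_comp_rpow_Ioi_of_pos (g := g) (two_pos : (0:ℝ) < 2)]
  norm_num [Real.rpow_two]

lemma integrableOn_Ioi_comp_sq {E : Type*} [NormedAddCommGroup E] [NormedSpace ℝ E]
    {g : ℝ → E} (hg : IntegrableOn g (Set.Ioi 0)) :
    IntegrableOn (fun μ : ℝ => (2 * μ) • g (μ ^ 2)) (Set.Ioi 0) := by
  have := (integrableOn_Ioi_comp_rpow_iff g (two_ne_zero : (2:ℝ) ≠ 0)).2 hg
  norm_num [Real.rpow_two] at this
  exact this

lemma integrableOn_sobolev_weight (F : 𝓢(ℝ, ℂ)) :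
    IntegrableOn (fun l : ℝ => (l ^ 2 + 1) ^ ((1:ℝ)/4) * ‖F l‖ ^ 2 * l ^ 2) (Set.Ioi 0) := by
  obtain ⟨C, -, hC⟩ := F.decay 0 0
  simp only [pow_zero, norm_iteratedFDeriv_zero, one_mul] at hC
  have hi : Integrable fun l : ℝ => C * (‖l‖ ^ 4 * ‖F l‖ + ‖l‖ ^ 2 * ‖F l‖) :=
    ((F.integrable_pow_mul volume 4).add (F.integrable_pow_mul volume 2)).const_mul C
  refine (hi.mono' (Continuous.aestronglyMeasurable ?_)
    (Filter.Eventually.of_forall fun l => ?_)).integrableOn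
  · have := F.continuous
    have h : Continuous fun l : ℝ => (l ^ 2 + 1) ^ ((1:ℝ)/4) :=
      Continuous.rpow_const (by fun_prop) fun l => Or.inr (by norm_num)
    fun_prop
  · rw [Real.norm_of_nonneg (by positivity)]
    have h1 : (l ^ 2 + 1) ^ ((1:ℝ)/4) ≤ l ^ 2 + 1 :=
      Real.rpow_le_self_of_one_le (by nlinarith [sq_nonneg l]) (by norm_num)
    have h4 : ‖l‖ ^ 4 = l ^ 2 * l ^ 2 := by
      rw [Real.norm_eq_abs, show |l| ^ 4 = |l| ^ 2 * |l| ^ 2 by ring, sq_abs]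
    have h2 : ‖l‖ ^ 2 = l ^ 2 := by rw [Real.norm_eq_abs, sq_abs]
    rw [h4, h2]
    calc (l ^ 2 + 1) ^ ((1:ℝ)/4) * ‖F l‖ ^ 2 * l ^ 2
        ≤ (l ^ 2 + 1) * (C * ‖F l‖) * l ^ 2 := by
          rw [sq ‖F l‖]
          gcongr
          exact hC l
      _ = C * (l ^ 2 * l ^ 2 * ‖F l‖ + l ^ 2 * ‖F l‖) := by ring

/-- The spherical transform of a radial function in the variable `μ = √λ`, including the
Plancherel and Jacobian factors. -/
noncomputable def sqrtProfile (F : 𝓢(ℝ, ℂ)) (μ : ℝ) : ℂ := 2 * (μ : ℂ) ^ 3 * F (μ ^ 2)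

lemma continuous_sqrtProfile (F : 𝓢(ℝ, ℂ)) : Continuous (sqrtProfile F) := by
  have := F.continuous
  unfold sqrtProfile
  fun_prop

lemma integrableOn_sqrtProfile (F : 𝓢(ℝ, ℂ)) : IntegrableOn (sqrtProfile F) (Set.Ioi 0) := by
  have h : IntegrableOn (fun l : ℝ => (l : ℂ) * F l) (Set.Ioi 0) := by
    have := F.continuous
    refine ((F.integrable_pow_mul volume 1).mono'
      (Continuous.aestronglyMeasurable (by fun_prop))
      (Filter.Eventually.of_forall fun l => ?_)).integrableOn
    simp
  refine (integrableOn_Ioi_comp_sq h).congr_fun (fun μ _ => ?_) measurableSet_Ioi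
  simp only [sqrtProfile, Complex.real_smul]
  push_cast
  ring

lemma norm_sq_sqrtProfile (F : 𝓢(ℝ, ℂ)) {μ : ℝ} (hμ : 0 < μ) :
    ‖sqrtProfile F μ‖ ^ 2 = (2 * μ) •
      (2 * (((μ ^ 2) ^ 2) ^ ((1:ℝ)/4) * ‖F (μ ^ 2)‖ ^ 2 * (μ ^ 2) ^ 2)) := by
  have h : ((μ ^ 2) ^ 2) ^ ((1:ℝ)/4) = μ := by
    rw [← pow_mul, ← Real.rpow_natCast, ← Real.rpow_mul hμ.le]
    norm_num
  rw [h, sqrtProfile, norm_mul, norm_mul, norm_pow, Complex.norm_real,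
    Real.norm_of_nonneg hμ.le, RCLike.norm_ofNat, smul_eq_mul]
  ring

lemma integral_norm_sq_sqrtProfile_le (F : 𝓢(ℝ, ℂ)) :
    IntegrableOn (fun μ => ‖sqrtProfile F μ‖ ^ 2) (Set.Ioi 0) ∧
    ∫ μ in Set.Ioi (0:ℝ), ‖sqrtProfile F μ‖ ^ 2
      ≤ 2 * ∫ l in Set.Ioi (0:ℝ), (l ^ 2 + 1) ^ ((1:ℝ)/4) * ‖F l‖ ^ 2 * l ^ 2 := by
  have hW := integrableOn_sobolev_weight F
  set h : ℝ → ℝ := fun l => 2 * ((l ^ 2) ^ ((1:ℝ)/4) * ‖F l‖ ^ 2 * l ^ 2) with hh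
  have hle : ∀ l, h l ≤ 2 * ((l ^ 2 + 1) ^ ((1:ℝ)/4) * ‖F l‖ ^ 2 * l ^ 2) := fun l => by
    simp only [hh]
    gcongr
    linarith
  have hi : IntegrableOn h (Set.Ioi 0) := by
    refine (hW.const_mul 2).mono' (Continuous.aestronglyMeasurable ?_)
      (Filter.Eventually.of_forall fun l => ?_)
    · have := F.continuous
      have h : Continuous fun l : ℝ => (l ^ 2) ^ ((1:ℝ)/4) :=
        Continuous.rpow_const (by fun_prop) fun l => Or.inr (by norm_num)
      fun_prop
    · rw [Real.norm_of_nonneg (by simp only [hh]; positivity)]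
      exact hle l
  constructor
  · exact (integrableOn_Ioi_comp_sq hi).congr_fun
      (fun μ hμ => (norm_sq_sqrtProfile F hμ).symm) measurableSet_Ioi
  · rw [setIntegral_congr_fun measurableSet_Ioi (fun μ hμ => norm_sq_sqrtProfile F hμ),
      ← integral_Ioi_eq_integral_comp_sq h, ← integral_const_mul]
    exact integral_mono hi (hW.const_mul 2) hle

/-- The half-wave part of the propagator applied to `F`. -/
noncomputable def waveIntegral (F : 𝓢(ℝ, ℂ)) (x t : ℝ) : ℂ :=
  ∫ μ in Set.Ioi (0:ℝ), quarticWave x t μ * sqrtProfile F μ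

lemma integrableOn_quarticWave_mul_sqrtProfile (F : 𝓢(ℝ, ℂ)) (x t : ℝ) :
    IntegrableOn (fun μ => quarticWave x t μ * sqrtProfile F μ) (Set.Ioi 0) :=
  Integrable.bdd_mul (integrableOn_sqrtProfile F)
    (continuous_quarticWave_apply x t).aestronglyMeasurable
    (Filter.Eventually.of_forall fun μ => (norm_quarticWave x t μ).le)

lemma continuous_waveIntegral (F : 𝓢(ℝ, ℂ)) :
    Continuous fun p : ℝ × ℝ => waveIntegral F p.1 p.2 := by
  refine continuous_of_dominated (bound := fun μ => ‖sqrtProfile F μ‖)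
    (fun p => (integrableOn_quarticWave_mul_sqrtProfile F p.1 p.2).aestronglyMeasurable)
    (fun p => Filter.Eventually.of_forall fun μ => ?_) (integrableOn_sqrtProfile F).norm
    (Filter.Eventually.of_forall fun μ => ?_)
  · rw [norm_mul, norm_quarticWave, one_mul]
  · exact (continuous_quarticWave.comp (by fun_prop : Continuous fun p : ℝ × ℝ =>
      (p.1, p.2, μ))).mul continuous_const

lemma norm_waveIntegral_le (F : 𝓢(ℝ, ℂ)) (x t : ℝ) :
    ‖waveIntegral F x t‖ ≤ ∫ μ in Set.Ioi (0:ℝ), ‖sqrtProfile F μ‖ := by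
  refine (norm_integral_le_integral_norm _).trans_eq ?_
  simp only [norm_mul, norm_quarticWave, one_mul]

lemma schrodinger_integral_eq (F : 𝓢(ℝ, ℂ)) {s : ℝ} (hs : 0 < s) (t : ℝ) :
    ∫ l in Set.Ioi (0:ℝ), ((Real.sin (l * s) / (l * Real.sinh s) : ℝ) : ℂ) *
        Complex.exp (Complex.I * ((t * (l ^ 2 + 1) : ℝ) : ℂ)) * F l * ((l : ℂ)) ^ 2
      = Complex.exp (Complex.I * t) / (Real.sinh s : ℂ) *
        (-(Complex.I / 2) * (waveIntegral F s t - waveIntegral F (-s) t)) := by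
  have hsh : (Real.sinh s : ℂ) ≠ 0 := by exact_mod_cast (Real.sinh_pos_iff.2 hs).ne'
  rw [integral_Ioi_eq_integral_comp_sq, waveIntegral, waveIntegral,
    ← integral_sub (integrableOn_quarticWave_mul_sqrtProfile F s t)
      (integrableOn_quarticWave_mul_sqrtProfile F (-s) t),
    ← integral_const_mul, ← integral_const_mul]
  refine setIntegral_congr_fun measurableSet_Ioi fun μ hμ => ?_
  have hμ0 : (μ : ℂ) ≠ 0 := by exact_mod_cast (ne_of_gt hμ)
  have h1 : Complex.exp (Complex.I * ((t * ((μ ^ 2) ^ 2 + 1) : ℝ) : ℂ))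
      = Complex.exp (Complex.I * t) * quarticWave 0 t μ := by
    rw [quarticWave, ← Complex.exp_add]
    congr 1
    push_cast
    ring
  have h2 : ((Real.sin (μ ^ 2 * s) : ℝ) : ℂ)
      = -(Complex.I / 2) * (quarticWave s 0 μ - quarticWave (-s) 0 μ) := by
    rw [Complex.ofReal_sin, Complex.sin, quarticWave, quarticWave,
      show -((μ ^ 2 * s : ℝ) : ℂ) * Complex.I
        = Complex.I * ((-s * μ ^ 2 + 0 * μ ^ 4 : ℝ) : ℂ) by push_cast; ring,
      show ((μ ^ 2 * s : ℝ) : ℂ) * Complex.I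
        = Complex.I * ((s * μ ^ 2 + 0 * μ ^ 4 : ℝ) : ℂ) by push_cast; ring]
    ring
  have h3 : ∀ x, quarticWave x t μ = quarticWave x 0 μ * quarticWave 0 t μ := fun x => by
    rw [quarticWave_mul, add_zero, zero_add]
  rw [h1, Complex.ofReal_div, h2, h3 s, h3 (-s), sqrtProfile, Complex.real_smul]
  push_cast
  field_simp

lemma exists_iSup_schrodinger_le (F : 𝓢(ℝ, ℂ)) :
    ∃ τ : ℝ → ℝ, Measurable τ ∧ ∀ s : ℝ, 0 < s →
      (⨆ t ∈ Set.Ioo (0:ℝ) 1, ‖∫ l in Set.Ioi (0:ℝ),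
          ((Real.sin (l * s) / (l * Real.sinh s) : ℝ) : ℂ) *
            Complex.exp (Complex.I * ((t * (l ^ 2 + 1) : ℝ) : ℂ)) * F l * ((l : ℂ)) ^ 2‖)
        * Real.sinh s ^ 2
      ≤ Real.sinh s * (‖waveIntegral F s (τ s)‖ + ‖waveIntegral F (-s) (τ s)‖) := by
  have hc := continuous_waveIntegral F
  set V : ℝ → ℝ → ℂ := fun s t => waveIntegral F s t - waveIntegral F (-s) t with hV
  have hVc : Continuous (Function.uncurry V) :=
    hc.sub (hc.comp (by fun_prop : Continuous fun p : ℝ × ℝ => (-p.1, p.2)))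
  obtain ⟨τ, hτ, hle⟩ := exists_measurable_norm_le_two_mul hVc fun s t =>
    (norm_sub_le _ _).trans (add_le_add (norm_waveIntegral_le F s t)
      (norm_waveIntegral_le F (-s) t))
  refine ⟨τ, hτ, fun s hs => ?_⟩
  have hsh : 0 < Real.sinh s := Real.sinh_pos_iff.2 hs
  have hnn : 0 ≤ ‖V s (τ s)‖ / Real.sinh s := by positivity
  have hsup : (⨆ t ∈ Set.Ioo (0:ℝ) 1, ‖∫ l in Set.Ioi (0:ℝ),
          ((Real.sin (l * s) / (l * Real.sinh s) : ℝ) : ℂ) *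
            Complex.exp (Complex.I * ((t * (l ^ 2 + 1) : ℝ) : ℂ)) * F l * ((l : ℂ)) ^ 2‖)
      ≤ ‖V s (τ s)‖ / Real.sinh s := by
    refine Real.iSup_le (fun t => Real.iSup_le (fun _ => ?_) hnn) hnn
    rw [schrodinger_integral_eq F hs t, norm_mul, norm_div, norm_mul, norm_neg, norm_div,
      Complex.norm_I, mul_comm Complex.I, Complex.norm_exp_ofReal_mul_I, Complex.norm_real,
      Real.norm_of_nonneg hsh.le, RCLike.norm_ofNat, div_mul_eq_mul_div, one_mul]
    have := hle s t
    gcongr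
    change 1 / 2 * ‖V s t‖ ≤ _
    linarith
  calc _ ≤ ‖V s (τ s)‖ / Real.sinh s * Real.sinh s ^ 2 := by gcongr
    _ = Real.sinh s * ‖V s (τ s)‖ := by field_simp
    _ ≤ _ := by
      gcongr
      exact norm_sub_le _ _

/-- **Maximal inequality on ℍ³ at the endpoint `α = 1/4` (Theorem 1.1 for radial data).**
For every `R > 0` there is `c > 0` such that for every even Schwartz function `F : ℝ → ℂ`
(playing the role of the spherical Fourier transform of the radial initial datum):
`∫_0^R sup_{0<t<1} |∫_0^∞ (sin(λs)/(λ sinh s)) e^{it(λ²+1)} F(λ) λ² dλ| sinh²(s) ds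
  ≤ c (∫_0^∞ (λ²+1)^{1/4} |F(λ)|² λ² dλ)^{1/2}`. -/
theorem hyperbolic_maximal_inequality (R : ℝ) (hR : 0 < R) :
    ∃ c : ℝ, 0 < c ∧ ∀ F : 𝓢(ℝ, ℂ), (∀ x : ℝ, F (-x) = F x) →
      (∫⁻ s in Set.Ioc (0:ℝ) R,
          ENNReal.ofReal ((⨆ t ∈ Set.Ioo (0:ℝ) 1,
              ‖∫ l in Set.Ioi (0:ℝ),
                  ((Real.sin (l * s) / (l * Real.sinh s) : ℝ) : ℂ) *
                    Complex.exp (Complex.I * ((t * (l ^ 2 + 1) : ℝ) : ℂ)) *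
                    F l * ((l : ℂ)) ^ 2‖) *
            Real.sinh s ^ 2))
        ≤ ENNReal.ofReal (c *
            (∫ l in Set.Ioi (0:ℝ), (l ^ 2 + 1) ^ ((1:ℝ)/4) * ‖F l‖ ^ 2 * l ^ 2)
              ^ ((1:ℝ)/2)) := by
  set K : ℝ := Real.sqrt (40 * (∫ y in (-R)..R, |y| ^ (-(1 / 2) : ℝ)) * R) with hK
  have hsR : 0 < Real.sinh R := Real.sinh_pos_iff.2 hR
  refine ⟨Real.sinh R * (2 * K * Real.sqrt 2) + 1, by positivity, fun F _ => ?_⟩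
  set N : ℝ := ∫ l in Set.Ioi (0:ℝ), (l ^ 2 + 1) ^ ((1:ℝ)/4) * ‖F l‖ ^ 2 * l ^ 2
  obtain ⟨τ, hτ, hle⟩ := exists_iSup_schrodinger_le F
  obtain ⟨hG2, hGN⟩ := integral_norm_sq_sqrtProfile_le F
  have hbound : ∀ ε : ℝ, |ε| = 1 →
      IntegrableOn (fun s => ‖waveIntegral F (ε * s) (τ s)‖) (Set.Ioc 0 R) ∧
        ∫ s in Set.Ioc 0 R, ‖waveIntegral F (ε * s) (τ s)‖ ≤ K * Real.sqrt (2 * N) := by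
    intro ε hε
    have hm : Measurable fun s => waveIntegral F (ε * s) (τ s) := by
      have hp : Measurable fun s : ℝ => (ε * s, τ s) := by fun_prop
      have := (continuous_waveIntegral F).measurable.comp hp
      exact this
    refine ⟨(Integrable.of_bound hm.aestronglyMeasurable _ (Filter.Eventually.of_forall
      fun s => norm_waveIntegral_le F (ε * s) (τ s))).norm, ?_⟩
    refine (integral_norm_integral_quarticWave_mul_le hR hε hτ (continuous_sqrtProfile F)
      (integrableOn_sqrtProfile F) hG2).trans ?_
    exact mul_le_mul_of_nonneg_left (Real.sqrt_le_sqrt hGN) (Real.sqrt_nonneg _)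
  obtain ⟨hi₁, hb₁⟩ := hbound 1 (by norm_num)
  obtain ⟨hi₂, hb₂⟩ := hbound (-1) (by norm_num)
  simp only [one_mul, neg_one_mul] at hi₁ hb₁ hi₂ hb₂
  calc _ ≤ ∫⁻ s in Set.Ioc (0:ℝ) R, ENNReal.ofReal (Real.sinh R *
        (‖waveIntegral F s (τ s)‖ + ‖waveIntegral F (-s) (τ s)‖)) := by
        refine setLIntegral_mono' measurableSet_Ioc fun s hs => ENNReal.ofReal_le_ofReal ?_
        refine (hle s hs.1).trans ?_
        gcongr
        exact Real.sinh_le_sinh.2 hs.2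
    _ = ENNReal.ofReal (∫ s in Set.Ioc (0:ℝ) R, Real.sinh R *
        (‖waveIntegral F s (τ s)‖ + ‖waveIntegral F (-s) (τ s)‖)) :=
        (ofReal_integral_eq_lintegral_ofReal ((hi₁.add hi₂).const_mul _)
          (Filter.Eventually.of_forall fun s =>
            mul_nonneg hsR.le (add_nonneg (norm_nonneg _) (norm_nonneg _)))).symm
    _ ≤ _ := by
        refine ENNReal.ofReal_le_ofReal ?_
        rw [integral_const_mul, integral_add hi₁ hi₂, ← Real.sqrt_eq_rpow]
        have h2 : Real.sqrt (2 * N) = Real.sqrt 2 * Real.sqrt N :=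
          Real.sqrt_mul (by norm_num) N
        rw [h2] at hb₁ hb₂
        have := mul_le_mul_of_nonneg_left (add_le_add hb₁ hb₂) hsR.le
        refine this.trans ?_
        nlinarith [Real.sqrt_nonneg N]
end

section
/- For every α with 0 ≤ α < 1/4 there is NO constant c > 0 such that for all even Schwartz functions F : ℝ → ℂ: ∫_0^{100} sup_{0 < t < 1} | ∫_0^∞ (sin(λ s)/(λ sinh s)) e^{i t (λ² + 1)} F(λ) λ² dλ | sinh²(s) ds ≤ c ( ∫_0^∞ (λ² + 1)^{α} |F(λ)|² λ² dλ )^{1/2}. -/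
open MeasureTheory
open scoped ENNReal NNReal SchwartzMap

open Filter Topology

namespace DahlbergKenig

/-- A smooth even cutoff supported in `[-1, 1]`. -/
noncomputable def cutoff : ContDiffBump (0 : ℝ) := ⟨1 / 2, 1, by norm_num, by norm_num⟩

lemma cutoff_eq_zero {x : ℝ} (hx : 1 ≤ |x|) : cutoff x = 0 :=
  cutoff.zero_of_le_dist (by simpa [cutoff] using hx)

lemma abs_lt_one_of_cutoff_ne_zero {x : ℝ} (hx : cutoff x ≠ 0) : |x| < 1 := by
  by_contra! h
  exact hx (cutoff_eq_zero h)

lemma integrable_mul_cutoff {f : ℝ → ℂ} (hf : Continuous f) :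
    Integrable fun x => f x * (cutoff x : ℂ) := by
  have hc := cutoff.continuous
  refine Continuous.integrable_of_hasCompactSupport (by fun_prop) ?_
  exact (cutoff.hasCompactSupport.comp_left (g := fun y : ℝ => (y : ℂ)) (by simp)).mul_left

/-- The wave packet of width `n` at frequencies `±n²`. -/
noncomputable def packetFun (n : ℕ) (x : ℝ) : ℂ :=
  (cutoff ((x - n ^ 2) / n) : ℂ) + (cutoff ((-x - n ^ 2) / n) : ℂ)

lemma hasCompactSupport_packetFun {n : ℕ} (hn : 0 < n) : HasCompactSupport (packetFun n) := by
  have hn' : (0 : ℝ) < n := by exact_mod_cast hn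
  refine HasCompactSupport.intro (isCompact_Icc (a := -((n : ℝ) ^ 2 + n)) (b := (n : ℝ) ^ 2 + n)) ?_
  intro x hx
  have hx' : (n : ℝ) ^ 2 + n < |x| := by
    by_contra! h
    exact hx (abs_le.mp h)
  have key (y : ℝ) (hy : |y| = |x|) : cutoff ((y - n ^ 2) / n) = 0 := by
    apply cutoff_eq_zero
    rw [abs_div, abs_of_pos hn', le_div_iff₀ hn']
    have := abs_sub_abs_le_abs_sub y ((n : ℝ) ^ 2)
    rw [abs_of_nonneg (sq_nonneg (n : ℝ)), hy] at this
    linarith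
  simp [packetFun, key x rfl, key (-x) (abs_neg x)]

lemma contDiff_packetFun (n : ℕ) : ContDiff ℝ (⊤ : ℕ∞) (packetFun n) := by
  have h : ContDiff ℝ (⊤ : ℕ∞) (fun x : ℝ => (cutoff x : ℂ)) :=
    Complex.ofRealCLM.contDiff.comp cutoff.contDiff
  have h1 : ContDiff ℝ (⊤ : ℕ∞) fun x : ℝ => (x - n ^ 2) / n := by fun_prop
  have h2 : ContDiff ℝ (⊤ : ℕ∞) fun x : ℝ => (-x - n ^ 2) / n := by fun_prop
  exact (h.comp h1).add (h.comp h2)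

/-- The wave packet `packetFun n` as a Schwartz function. -/
noncomputable def packet {n : ℕ} (hn : 0 < n) : 𝓢(ℝ, ℂ) :=
  (hasCompactSupport_packetFun hn).toSchwartzMap (contDiff_packetFun n)

lemma packet_neg {n : ℕ} (hn : 0 < n) (x : ℝ) : packet hn (-x) = packet hn x := by
  simp [packet, packetFun, add_comm]

lemma packet_of_pos {n : ℕ} (hn : 0 < n) {x : ℝ} (hx : 0 < x) :
    packet hn x = (cutoff ((x - n ^ 2) / n) : ℂ) := by
  have hn' : (1 : ℝ) ≤ n := by exact_mod_cast hn
  have : cutoff ((-x - n ^ 2) / n) = 0 := by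
    apply cutoff_eq_zero
    rw [abs_div, abs_of_pos (by linarith : (0 : ℝ) < n), le_div_iff₀ (by linarith)]
    rw [abs_of_nonpos (by nlinarith)]
    nlinarith
  simp [packet, packetFun, this]

lemma cutoff_rescaled_ne_zero_bounds {n : ℕ} (hn : 0 < n) {x : ℝ}
    (hx : cutoff ((x - n ^ 2) / n) ≠ 0) : (n : ℝ) ^ 2 - n < x ∧ x < (n : ℝ) ^ 2 + n := by
  have hn' : (0 : ℝ) < n := by exact_mod_cast hn
  have h := abs_lt_one_of_cutoff_ne_zero hx
  rw [abs_div, abs_of_pos hn', div_lt_one hn', abs_lt] at h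
  constructor <;> linarith [h.1, h.2]

/-- The rescaled evolution of the wave packet at time `s / (2n²)`. -/
noncomputable def rescaledEvolution (n : ℕ) (s : ℝ) : ℂ :=
  ∫ x : ℝ, (1 + (x : ℂ) / n) * ((Real.sin ((n ^ 2 + n * x) * s) : ℝ) : ℂ) *
    Complex.exp (Complex.I * ((s / (2 * n ^ 2) * ((n ^ 2 + n * x) ^ 2 + 1) : ℝ) : ℂ)) *
    (cutoff x : ℂ)

lemma measurable_rescaledEvolution (n : ℕ) : Measurable (rescaledEvolution n) := by
  have hc := cutoff.continuous
  refine StronglyMeasurable.measurable ?_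
  refine StronglyMeasurable.integral_prod_right (f := fun s x : ℝ =>
    (1 + (x : ℂ) / n) * ((Real.sin ((n ^ 2 + n * x) * s) : ℝ) : ℂ) *
    Complex.exp (Complex.I * ((s / (2 * n ^ 2) * ((n ^ 2 + n * x) ^ 2 + 1) : ℝ) : ℂ)) *
    (cutoff x : ℂ)) ?_
  refine Continuous.stronglyMeasurable ?_
  simp only [Function.uncurry_def]
  fun_prop

/-- The limiting profile of the modulus of the rescaled evolution. -/
noncomputable def profile (s : ℝ) : ℂ :=
  ∫ x : ℝ, Complex.exp (Complex.I * ((s * x ^ 2 / 2 : ℝ) : ℂ)) * (cutoff x : ℂ)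

lemma profile_ne_zero {s : ℝ} (hs0 : 0 < s) (hs1 : s ≤ 1) : profile s ≠ 0 := by
  have hc := cutoff.continuous
  have hint : Integrable fun x : ℝ =>
      Complex.exp (Complex.I * ((s * x ^ 2 / 2 : ℝ) : ℂ)) * (cutoff x : ℂ) :=
    integrable_mul_cutoff (by fun_prop)
  have hre : (profile s).re = ∫ x : ℝ, Real.cos (s * x ^ 2 / 2) * cutoff x := by
    rw [profile, ← RCLike.re_eq_complex_re, ← integral_re hint]
    congr 1 with x
    rw [RCLike.re_eq_complex_re, Complex.re_mul_ofReal, mul_comm Complex.I, Complex.exp_ofReal_mul_I_re]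
  have hpos : 0 < (profile s).re := by
    rw [hre]
    refine Continuous.integral_pos_of_hasCompactSupport_nonneg_nonzero (x := 0) (by fun_prop)
      cutoff.hasCompactSupport.mul_left ?_ ?_
    · intro x
      by_cases hx : cutoff x = 0
      · simp [hx]
      · have h := abs_lt_one_of_cutoff_ne_zero hx
        have hx2 : x ^ 2 < 1 := (sq_lt_one_iff_abs_lt_one x).mpr h
        refine mul_nonneg (Real.cos_nonneg_of_mem_Icc ⟨?_, ?_⟩) cutoff.nonneg
        · nlinarith [Real.pi_gt_three, sq_nonneg x]
        · nlinarith [Real.pi_gt_three, sq_nonneg x]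
    · have : cutoff 0 = 1 := cutoff.one_of_mem_closedBall (by simp [cutoff])
      simp [this]
  intro h
  simp [h] at hpos

lemma sin_mul_exp_phase {n s x : ℂ} (hn : n ≠ 0) :
    2 * Complex.I * (Complex.sin ((n ^ 2 + n * x) * s) *
      Complex.exp (Complex.I * (s / (2 * n ^ 2) * ((n ^ 2 + n * x) ^ 2 + 1)))) =
    Complex.exp ((s / (2 * n ^ 2) + 3 * s * n ^ 2 / 2) * Complex.I) *
      (Complex.exp (2 * s * n * x * Complex.I) * Complex.exp (Complex.I * (s * x ^ 2 / 2))) -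
    Complex.exp ((s / (2 * n ^ 2) - s * n ^ 2 / 2) * Complex.I) *
      Complex.exp (Complex.I * (s * x ^ 2 / 2)) := by
  have h := Complex.two_sin ((n ^ 2 + n * x) * s)
  have : 2 * Complex.I * Complex.sin ((n ^ 2 + n * x) * s) =
      Complex.exp ((n ^ 2 + n * x) * s * Complex.I) -
        Complex.exp (-((n ^ 2 + n * x) * s) * Complex.I) := by
    linear_combination Complex.I * h + (Complex.exp (-((n ^ 2 + n * x) * s) * Complex.I) -
      Complex.exp ((n ^ 2 + n * x) * s * Complex.I)) * Complex.I_sq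
  rw [← mul_assoc, this, sub_mul]
  simp only [← Complex.exp_add]
  congr 2
  · field_simp
    ring
  · field_simp
    ring

lemma tendsto_integral_one_add_div {f : ℕ → ℝ → ℂ} (hf : ∀ n, Continuous (f n)) {a b : ℂ}
    (ha : Tendsto (fun n => ∫ x, f n x * (cutoff x : ℂ)) atTop (𝓝 a))
    (hb : Tendsto (fun n => ∫ x : ℝ, (x * f n x) * (cutoff x : ℂ)) atTop (𝓝 b)) :
    Tendsto (fun n : ℕ => ∫ x : ℝ, ((1 + (x : ℂ) / n) * f n x) * (cutoff x : ℂ)) atTop (𝓝 a) := by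
  have h0 : Tendsto (fun n : ℕ => ((n : ℂ))⁻¹) atTop (𝓝 0) := tendsto_inv_atTop_nhds_zero_nat (𝕜 := ℂ)
  have h := ha.add (h0.mul hb)
  rw [zero_mul, add_zero] at h
  refine h.congr fun n => ?_
  have hn := hf n
  rw [← integral_const_mul, ← integral_add (integrable_mul_cutoff hn)
    ((integrable_mul_cutoff (by fun_prop)).const_mul _)]
  congr 1 with x
  ring

lemma tendsto_integral_exp_mul {s : ℝ} (hs : 0 < s) (f : ℝ → ℂ) :
    Tendsto (fun n : ℕ => ∫ x : ℝ, Complex.exp (2 * s * n * x * Complex.I) * f x)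
      atTop (𝓝 0) := by
  have h := Real.tendsto_integral_exp_smul_cocompact f
  have hw : Tendsto (fun n : ℕ => -(s * n / Real.pi)) atTop (cocompact ℝ) := by
    refine Tendsto.mono_right ?_ atBot_le_cocompact
    refine tendsto_neg_atTop_atBot.comp ?_
    exact (tendsto_natCast_atTop_atTop.const_mul_atTop hs).atTop_div_const Real.pi_pos
  refine (h.comp hw).congr fun n => ?_
  simp only [Function.comp_apply]
  congr 1 with x
  rw [Circle.smul_def, Real.fourierChar_apply, smul_eq_mul]
  congr 2
  have : (Real.pi : ℂ) ≠ 0 := by exact_mod_cast Real.pi_ne_zero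
  push_cast
  field_simp

lemma rescaledEvolution_eq {n : ℕ} (hn : 0 < n) (s : ℝ) :
    2 * Complex.I * rescaledEvolution n s =
    Complex.exp (((s / (2 * n ^ 2) + 3 * s * n ^ 2 / 2 : ℝ) : ℂ) * Complex.I) *
      (∫ x : ℝ, ((1 + (x : ℂ) / n) * (Complex.exp (2 * s * n * x * Complex.I) *
        Complex.exp (Complex.I * ((s * x ^ 2 / 2 : ℝ) : ℂ)))) * (cutoff x : ℂ)) -
    Complex.exp (((s / (2 * n ^ 2) - s * n ^ 2 / 2 : ℝ) : ℂ) * Complex.I) *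
      ∫ x : ℝ, ((1 + (x : ℂ) / n) * Complex.exp (Complex.I * ((s * x ^ 2 / 2 : ℝ) : ℂ))) *
        (cutoff x : ℂ) := by
  rw [rescaledEvolution, ← integral_const_mul, ← integral_const_mul, ← integral_const_mul,
    ← integral_sub ((integrable_mul_cutoff (by fun_prop)).const_mul _)
      ((integrable_mul_cutoff (by fun_prop)).const_mul _)]
  congr 1 with x
  have hn' : (n : ℂ) ≠ 0 := by exact_mod_cast hn.ne'
  have h := sin_mul_exp_phase (s := s) (x := x) hn'
  push_cast
  linear_combination (1 + (x : ℂ) / n) * (cutoff x : ℂ) * h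

lemma eventually_norm_profile_le {s : ℝ} (hs0 : 0 < s) (hs1 : s ≤ 1) :
    ∀ᶠ n : ℕ in atTop, ‖profile s‖ / 4 ≤ ‖rescaledEvolution n s‖ := by
  have hP := tendsto_integral_one_add_div
    (f := fun _ x => Complex.exp (Complex.I * ((s * x ^ 2 / 2 : ℝ) : ℂ)))
    (fun _ => by fun_prop) tendsto_const_nhds tendsto_const_nhds
  have hQ := tendsto_integral_one_add_div (a := 0) (b := 0)
    (f := fun n x => Complex.exp (2 * s * n * x * Complex.I) *
        Complex.exp (Complex.I * ((s * x ^ 2 / 2 : ℝ) : ℂ)))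
    (fun _ => by fun_prop)
    ((tendsto_integral_exp_mul hs0 fun x : ℝ =>
      Complex.exp (Complex.I * ((s * x ^ 2 / 2 : ℝ) : ℂ)) * (cutoff x : ℂ)).congr fun n => by
        congr 1 with x; ring)
    ((tendsto_integral_exp_mul hs0 fun x : ℝ =>
      x * Complex.exp (Complex.I * ((s * x ^ 2 / 2 : ℝ) : ℂ)) * (cutoff x : ℂ)).congr fun n => by
        congr 1 with x; ring)
  have hlim := (hP.norm.sub hQ.norm)
  have hpos : 0 < ‖profile s‖ := norm_pos_iff.mpr (profile_ne_zero hs0 hs1)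
  rw [norm_zero, sub_zero] at hlim
  change Tendsto _ _ (𝓝 ‖profile s‖) at hlim
  filter_upwards [hlim.eventually_const_le (half_lt_self hpos), eventually_gt_atTop 0]
    with n hn hn0
  have h := congrArg norm (rescaledEvolution_eq hn0 s)
  have h2 := norm_sub_norm_le
    (Complex.exp (((s / (2 * n ^ 2) - s * n ^ 2 / 2 : ℝ) : ℂ) * Complex.I) *
      ∫ x : ℝ, ((1 + (x : ℂ) / n) * Complex.exp (Complex.I * ((s * x ^ 2 / 2 : ℝ) : ℂ))) *
        (cutoff x : ℂ))
    (Complex.exp (((s / (2 * n ^ 2) + 3 * s * n ^ 2 / 2 : ℝ) : ℂ) * Complex.I) *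
      (∫ x : ℝ, ((1 + (x : ℂ) / n) * (Complex.exp (2 * s * n * x * Complex.I) *
        Complex.exp (Complex.I * ((s * x ^ 2 / 2 : ℝ) : ℂ)))) * (cutoff x : ℂ)))
  rw [norm_sub_rev, ← h, norm_mul, norm_mul, norm_mul, norm_mul, Complex.norm_exp_ofReal_mul_I,
    Complex.norm_exp_ofReal_mul_I, Complex.norm_I, Complex.norm_ofNat] at h2
  linarith

lemma integral_packet_eq {n : ℕ} (hn : 0 < n) {s : ℝ} (hs : 0 < s) :
    ∫ l in Set.Ioi (0 : ℝ), ((Real.sin (l * s) / (l * Real.sinh s) : ℝ) : ℂ) *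
      Complex.exp (Complex.I * ((s / (2 * n ^ 2) * (l ^ 2 + 1) : ℝ) : ℂ)) *
      packet hn l * (l : ℂ) ^ 2 = (n : ℂ) ^ 3 / Real.sinh s * rescaledEvolution n s := by
  have hn' : (1 : ℝ) ≤ n := by exact_mod_cast hn
  have hnC : (n : ℂ) ≠ 0 := by exact_mod_cast hn.ne'
  set g : ℝ → ℂ := fun l => (l : ℂ) * ((Real.sin (l * s) : ℝ) : ℂ) *
      Complex.exp (Complex.I * ((s / (2 * n ^ 2) * (l ^ 2 + 1) : ℝ) : ℂ)) *
      (cutoff ((l - n ^ 2) / n) : ℂ) / Real.sinh s with hg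
  have h1 : ∫ l in Set.Ioi (0 : ℝ), ((Real.sin (l * s) / (l * Real.sinh s) : ℝ) : ℂ) *
      Complex.exp (Complex.I * ((s / (2 * n ^ 2) * (l ^ 2 + 1) : ℝ) : ℂ)) *
      packet hn l * (l : ℂ) ^ 2 = ∫ l in Set.Ioi (0 : ℝ), g l := by
    refine setIntegral_congr_fun measurableSet_Ioi fun l (hl : 0 < l) => ?_
    have hl' : (l : ℂ) ≠ 0 := by exact_mod_cast hl.ne'
    have hsh : (Real.sinh s : ℂ) ≠ 0 := by exact_mod_cast (Real.sinh_pos_iff.mpr hs).ne'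
    simp only [hg]
    rw [packet_of_pos hn hl, Complex.ofReal_div, Complex.ofReal_mul]
    field_simp
  rw [h1, setIntegral_eq_integral_of_forall_compl_eq_zero]
  · have h2 : ∫ x : ℝ, g (n * x + n ^ 2) = ((n : ℝ)⁻¹ : ℝ) • ∫ l, g l := by
      rw [Measure.integral_comp_mul_left (fun y => g (y + (n : ℝ) ^ 2)) (n : ℝ),
        integral_add_right_eq_self g, abs_of_nonneg (by positivity)]
    have h3 : ∫ l, g l = n * ∫ x : ℝ, g (n * x + n ^ 2) := by
      rw [h2, Complex.real_smul]
      push_cast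
      field_simp
    rw [h3, rescaledEvolution, ← integral_const_mul, ← integral_const_mul]
    congr 1 with x
    have hx : ((n : ℝ) * x + n ^ 2 - n ^ 2) / n = x := by
      field_simp
      ring
    simp only [hg, hx]
    rw [add_comm ((n : ℝ) * x)]
    push_cast
    field_simp
  · intro l hl
    have : cutoff ((l - n ^ 2) / n) = 0 := by
      by_contra h
      have := (cutoff_rescaled_ne_zero_bounds hn h).1
      have hl' : l ≤ 0 := not_lt.mp hl
      nlinarith
    simp [hg, this]

lemma le_iSup_maximal {n : ℕ} (hn : 0 < n) {s : ℝ} (hs0 : 0 < s) (hs1 : s ≤ 1) :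
    (n : ℝ) ^ 3 * (Real.sinh s * ‖rescaledEvolution n s‖) ≤
      (⨆ t ∈ Set.Ioo (0:ℝ) 1,
              ‖∫ l in Set.Ioi (0:ℝ),
                  ((Real.sin (l * s) / (l * Real.sinh s) : ℝ) : ℂ) *
                    Complex.exp (Complex.I * ((t * (l ^ 2 + 1) : ℝ) : ℂ)) *
                    packet hn l * ((l : ℂ)) ^ 2‖) *
            Real.sinh s ^ 2 := by
  have hn' : (1 : ℝ) ≤ n := by exact_mod_cast hn
  have hsh := Real.sinh_pos_iff.mpr hs0
  set v : ℝ → ℝ := fun t => ‖∫ l in Set.Ioi (0:ℝ),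
                  ((Real.sin (l * s) / (l * Real.sinh s) : ℝ) : ℂ) *
                    Complex.exp (Complex.I * ((t * (l ^ 2 + 1) : ℝ) : ℂ)) *
                    packet hn l * ((l : ℂ)) ^ 2‖ with hv
  have hbound (t : ℝ) : v t ≤ ∫ l in Set.Ioi (0 : ℝ),
      ‖((Real.sin (l * s) / (l * Real.sinh s) : ℝ) : ℂ)‖ * ‖packet hn l‖ * ‖(l : ℂ) ^ 2‖ := by
    refine (norm_integral_le_integral_norm _).trans_eq ?_
    congr 1 with l
    rw [norm_mul, norm_mul, norm_mul, mul_comm Complex.I, Complex.norm_exp_ofReal_mul_I, mul_one]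
  have hbdd : BddAbove (Set.range fun t => ⨆ _ : t ∈ Set.Ioo (0 : ℝ) 1, v t) := by
    refine ⟨∫ l in Set.Ioi (0 : ℝ),
      ‖((Real.sin (l * s) / (l * Real.sinh s) : ℝ) : ℂ)‖ * ‖packet hn l‖ * ‖(l : ℂ) ^ 2‖, ?_⟩
    rintro _ ⟨t, rfl⟩
    exact Real.iSup_le (fun _ => hbound t) ((norm_nonneg _).trans (hbound 0))
  have ht : s / (2 * n ^ 2) ∈ Set.Ioo (0 : ℝ) 1 :=
    ⟨by positivity, by rw [div_lt_one (by positivity)]; nlinarith⟩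
  have hle : v (s / (2 * n ^ 2)) ≤ ⨆ t ∈ Set.Ioo (0 : ℝ) 1, v t := by
    refine le_ciSup_of_le hbdd (s / (2 * n ^ 2)) ?_
    rw [ciSup_pos ht]
  refine le_trans (le_of_eq ?_) (mul_le_mul_of_nonneg_right hle (sq_nonneg _))
  simp only [hv]
  rw [integral_packet_eq hn hs0, norm_mul, norm_div, norm_pow, Complex.norm_natCast,
    Complex.norm_real, Real.norm_of_nonneg hsh.le]
  field_simp

lemma sobolevNorm_packet_le {α : ℝ} (hα0 : 0 ≤ α) {n : ℕ} (hn : 0 < n) :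
    (∫ l in Set.Ioi (0:ℝ), (l ^ 2 + 1) ^ α * ‖packet hn l‖ ^ 2 * l ^ 2) ^ ((1:ℝ)/2) ≤
      (n : ℝ) ^ 3 * ((8 * 5 ^ α) ^ ((1:ℝ)/2) * (n : ℝ) ^ (2 * α - 1 / 2)) := by
  have hn' : (1 : ℝ) ≤ n := by exact_mod_cast hn
  have hn0 : (0 : ℝ) < n := by linarith
  set M : ℝ := (5 * (n : ℝ) ^ 4) ^ α * (4 * (n : ℝ) ^ 4) with hM
  have hM0 : 0 ≤ M := by positivity
  have hle : ∫ l in Set.Ioi (0:ℝ), (l ^ 2 + 1) ^ α * ‖packet hn l‖ ^ 2 * l ^ 2 ≤ M * (2 * n) := by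
    have hind : ∫ l, (Set.Icc ((n : ℝ) ^ 2 - n) (n ^ 2 + n)).indicator (fun _ => M) l
        = M * (2 * n) := by
      rw [integral_indicator measurableSet_Icc, setIntegral_const, smul_eq_mul,
        Real.volume_real_Icc_of_le (by linarith)]
      ring
    have hint : Integrable ((Set.Icc ((n : ℝ) ^ 2 - n) (n ^ 2 + n)).indicator (fun _ => M)) :=
      (integrable_indicator_iff measurableSet_Icc).mpr
        (integrableOn_const (by simp))
    rw [← hind]
    refine le_trans (integral_mono_of_nonneg (g := (Set.Icc ((n : ℝ) ^ 2 - n)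
      (n ^ 2 + n)).indicator (fun _ => M)) (ae_of_all _ fun l => by positivity)
      hint.integrableOn ?_) (setIntegral_le_integral hint (ae_of_all _ fun l =>
        Set.indicator_nonneg (fun _ _ => hM0) l))
    refine (ae_restrict_iff' measurableSet_Ioi).mpr (ae_of_all _ fun l (hl : 0 < l) => ?_)
    simp only [packet_of_pos hn hl]
    by_cases hz : cutoff ((l - n ^ 2) / n) = 0
    · simp only [hz, Complex.ofReal_zero, norm_zero]
      simpa using Set.indicator_nonneg (fun _ _ => hM0) l
    · obtain ⟨h1, h2⟩ := cutoff_rescaled_ne_zero_bounds hn hz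
      rw [Set.indicator_of_mem (Set.mem_Icc.mpr ⟨h1.le, h2.le⟩), Complex.norm_real,
        Real.norm_of_nonneg cutoff.nonneg]
      have hl2 : l ≤ 2 * (n : ℝ) ^ 2 := by nlinarith
      have hl4 : l ^ 2 ≤ 4 * (n : ℝ) ^ 4 := by nlinarith
      have hn4 : (1 : ℝ) ≤ (n : ℝ) ^ 4 := one_le_pow₀ hn'
      have hpow : (l ^ 2 + 1) ^ α ≤ (5 * (n : ℝ) ^ 4) ^ α :=
        Real.rpow_le_rpow (by positivity) (by linarith) hα0
      have hc : cutoff ((l - n ^ 2) / n) ^ 2 ≤ 1 := pow_le_one₀ cutoff.nonneg cutoff.le_one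
      calc (l ^ 2 + 1) ^ α * cutoff ((l - n ^ 2) / n) ^ 2 * l ^ 2
          ≤ (5 * (n : ℝ) ^ 4) ^ α * 1 * (4 * (n : ℝ) ^ 4) := by gcongr
        _ = M := by rw [mul_one]
  refine (Real.rpow_le_rpow ?_ hle (by norm_num)).trans_eq ?_
  · exact integral_nonneg fun l => by positivity
  · have e1 : M * (2 * n) = (8 * 5 ^ α) * (n : ℝ) ^ (4 * α + 5) := by
      rw [hM, Real.mul_rpow (by norm_num) (by positivity), ← Real.rpow_natCast (n : ℝ) 4,
        ← Real.rpow_mul hn0.le, Real.rpow_add hn0]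
      have : (n : ℝ) ^ (5 : ℝ) = (n : ℝ) ^ ((4 : ℕ) : ℝ) * n := by
        rw [← Real.rpow_add_one hn0.ne']
        norm_num
      rw [this]
      push_cast
      ring
    rw [e1, Real.mul_rpow (by positivity) (by positivity), ← Real.rpow_mul hn0.le,
      ← Real.rpow_natCast (n : ℝ) 3, mul_left_comm, ← Real.rpow_add hn0]
    congr 2
    push_cast
    ring

lemma liminf_rescaledEvolution_ne_zero :
    liminf (fun n : ℕ => ∫⁻ s in Set.Ioc (0 : ℝ) 1,
      ENNReal.ofReal (Real.sinh s * ‖rescaledEvolution n s‖)) atTop ≠ 0 := by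
  intro h0
  have hmeas (n : ℕ) : Measurable fun s : ℝ =>
      ENNReal.ofReal (Real.sinh s * ‖rescaledEvolution n s‖) :=
    (Real.measurable_sinh.mul (measurable_rescaledEvolution n).norm).ennreal_ofReal
  have h := lintegral_liminf_le (μ := volume.restrict (Set.Ioc (0 : ℝ) 1)) (u := atTop) hmeas
  rw [h0, nonpos_iff_eq_zero, lintegral_eq_zero_iff (Measurable.liminf hmeas)] at h
  have hfalse : ∀ᵐ s ∂(volume.restrict (Set.Ioc (0 : ℝ) 1)), False := by
    filter_upwards [h, ae_restrict_mem measurableSet_Ioc] with s hs ⟨hs0, hs1⟩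
    have hsh := Real.sinh_pos_iff.mpr hs0
    have hpos : 0 < ‖profile s‖ := norm_pos_iff.mpr (profile_ne_zero hs0 hs1)
    have hle : ENNReal.ofReal (Real.sinh s * (‖profile s‖ / 4)) ≤
        liminf (fun n : ℕ => ENNReal.ofReal (Real.sinh s * ‖rescaledEvolution n s‖)) atTop := by
      refine le_liminf_of_le (h := ?_)
      filter_upwards [eventually_norm_profile_le hs0 hs1] with n hn
      gcongr
    have hs' : liminf (fun n : ℕ => ENNReal.ofReal (Real.sinh s * ‖rescaledEvolution n s‖))
      atTop = 0 := hs
    rw [hs', nonpos_iff_eq_zero, ENNReal.ofReal_eq_zero] at hle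
    have : 0 < Real.sinh s * (‖profile s‖ / 4) := by positivity
    linarith
  rw [eventually_false_iff_eq_bot, ae_eq_bot, Measure.restrict_eq_zero] at hfalse
  simp at hfalse

end DahlbergKenig

open DahlbergKenig

/-- **Sharpness of the exponent 1/4 on ℍ³ (Theorem 1.3).**
For every `0 ≤ α < 1/4` there is NO constant `c > 0` such that for all even Schwartz
`F : ℝ → ℂ`:
`∫_0^{100} sup_{0<t<1} |∫_0^∞ (sin(λs)/(λ sinh s)) e^{it(λ²+1)} F(λ) λ² dλ| sinh²(s) ds
  ≤ c (∫_0^∞ (λ²+1)^{α} |F(λ)|² λ² dλ)^{1/2}`. -/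
theorem hyperbolic_maximal_inequality_fails_below_quarter
    (α : ℝ) (hα0 : 0 ≤ α) (hα : α < 1 / 4) :
    ¬ ∃ c : ℝ, 0 < c ∧ ∀ F : 𝓢(ℝ, ℂ), (∀ x : ℝ, F (-x) = F x) →
      (∫⁻ s in Set.Ioc (0:ℝ) 100,
          ENNReal.ofReal ((⨆ t ∈ Set.Ioo (0:ℝ) 1,
              ‖∫ l in Set.Ioi (0:ℝ),
                  ((Real.sin (l * s) / (l * Real.sinh s) : ℝ) : ℂ) *
                    Complex.exp (Complex.I * ((t * (l ^ 2 + 1) : ℝ) : ℂ)) *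
                    F l * ((l : ℂ)) ^ 2‖) *
            Real.sinh s ^ 2))
        ≤ ENNReal.ofReal (c *
            (∫ l in Set.Ioi (0:ℝ), (l ^ 2 + 1) ^ α * ‖F l‖ ^ 2 * l ^ 2)
              ^ ((1:ℝ)/2)) := by
  rintro ⟨c, hc, H⟩
  have key (n : ℕ) (hn : 0 < n) : ∫⁻ s in Set.Ioc (0 : ℝ) 1,
      ENNReal.ofReal (Real.sinh s * ‖rescaledEvolution n s‖) ≤
      ENNReal.ofReal (c * ((8 * 5 ^ α) ^ ((1:ℝ)/2) * (n : ℝ) ^ (2 * α - 1 / 2))) := by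
    have hn' : (0 : ℝ) < n := by exact_mod_cast hn
    have hn3 : ENNReal.ofReal ((n : ℝ) ^ 3) ≠ 0 := (ENNReal.ofReal_pos.mpr (by positivity)).ne'
    rw [← ENNReal.mul_le_mul_iff_right hn3 ENNReal.ofReal_ne_top,
      ← lintegral_const_mul' _ _ ENNReal.ofReal_ne_top, ← ENNReal.ofReal_mul (by positivity)]
    refine le_trans ?_ ((H (packet hn) (packet_neg hn)).trans (ENNReal.ofReal_le_ofReal ?_))
    · refine le_trans (setLIntegral_mono' measurableSet_Ioc fun s hs => ?_)
        (lintegral_mono_set (Set.Ioc_subset_Ioc_right (by norm_num)))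
      rw [← ENNReal.ofReal_mul (by positivity)]
      exact ENNReal.ofReal_le_ofReal (le_iSup_maximal hn hs.1 hs.2)
    · rw [mul_left_comm]
      exact mul_le_mul_of_nonneg_left (sobolevNorm_packet_le hα0 hn) hc.le
  have hpow : Tendsto (fun n : ℕ => (n : ℝ) ^ (2 * α - 1 / 2)) atTop (𝓝 0) := by
    have := (tendsto_rpow_neg_atTop (by linarith : 0 < 1 / 2 - 2 * α)).comp
      (tendsto_natCast_atTop_atTop (R := ℝ))
    simpa [Function.comp_def, neg_sub] using this
  have hlim := ENNReal.tendsto_ofReal ((hpow.const_mul ((8 * 5 ^ α) ^ ((1:ℝ)/2))).const_mul c)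
  rw [mul_zero, mul_zero, ENNReal.ofReal_zero] at hlim
  have hzero := tendsto_of_tendsto_of_tendsto_of_le_of_le' tendsto_const_nhds hlim
    (Eventually.of_forall fun _ => zero_le)
    ((eventually_gt_atTop 0).mono key)
  exact liminf_rescaledEvolution_ne_zero hzero.liminf_eq
end

section
/- There exists a constant C ≥ 1 such that for every measurable F : ℝ → ℂ with ∫_0^∞ |F(λ)| λ² dλ < ∞, setting u(s,t) = ∫_0^∞ (sin(λ s)/(λ sinh s)) e^{i t (λ² + 1)} F(λ) λ² dλ and ũ(s,t) = ∫_0^∞ (sin(λ s)/(λ s)) e^{i t λ²} F(λ) λ² dλ, one has: (1/C) ∫_0^{100} sup_{0 < t < 1} |ũ(s,t)| s² ds ≤ ∫_0^{100} sup_{0 < t < 1} |u(s,t)| sinh²(s) ds ≤ C ∫_0^{100} sup_{0 < t < 1} |ũ(s,t)| s² ds. -/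
open MeasureTheory
open scoped ENNReal NNReal

/-- On `[0, b]`, the hyperbolic sine lies below the line through the origin of slope `cosh b`. -/
theorem Real.sinh_le_cosh_mul_of_le {s b : ℝ} (hs : 0 ≤ s) (hb : s ≤ b) :
    Real.sinh s ≤ Real.cosh b * s := by
  have h := (convex_Icc (0 : ℝ) b).image_sub_le_mul_sub_of_deriv_le
    Real.continuous_sinh.continuousOn Real.differentiable_sinh.differentiableOn
    (C := Real.cosh b) (fun x hx => by
      rw [interior_Icc] at hx
      rw [Real.deriv_sinh, Real.cosh_le_cosh, abs_of_pos hx.1, abs_of_pos (hx.1.trans hx.2)]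
      exact hx.2.le)
    0 ⟨le_rfl, hs.trans hb⟩ s ⟨hs, hb⟩ hs
  simpa using h

/-- For fixed `s` and `t`, the hyperbolic and Euclidean solutions have moduli differing by the
factor `s / sinh s`. -/
theorem norm_integral_hyperbolic_eq (F : ℝ → ℂ) {s : ℝ} (hs : 0 < s) (t : ℝ) :
    ‖∫ l in Set.Ioi (0:ℝ),
        ((Real.sin (l * s) / (l * Real.sinh s) : ℝ) : ℂ) *
          Complex.exp (Complex.I * ((t * (l ^ 2 + 1) : ℝ) : ℂ)) *
          F l * ((l : ℂ)) ^ 2‖ =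
      s / Real.sinh s * ‖∫ l in Set.Ioi (0:ℝ),
        ((Real.sin (l * s) / (l * s) : ℝ) : ℂ) *
          Complex.exp (Complex.I * ((t * l ^ 2 : ℝ) : ℂ)) *
          F l * ((l : ℂ)) ^ 2‖ := by
  have hsinh : 0 < Real.sinh s := Real.sinh_pos_iff.mpr hs
  have hphase : ‖Complex.exp (Complex.I * (t : ℂ))‖ = 1 := by
    rw [mul_comm, Complex.norm_exp_ofReal_mul_I]
  have hscale : ‖((s / Real.sinh s : ℝ) : ℂ) * Complex.exp (Complex.I * (t : ℂ))‖ =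
      s / Real.sinh s := by
    rw [norm_mul, hphase, mul_one, Complex.norm_real, Real.norm_of_nonneg (by positivity)]
  rw [← hscale, ← norm_mul, ← integral_const_mul]
  congr 2 with l
  have hkernel : Real.sin (l * s) / (l * Real.sinh s) =
      s / Real.sinh s * (Real.sin (l * s) / (l * s)) := by
    rw [div_mul_div_comm, mul_comm (Real.sinh s), mul_right_comm, mul_comm (_ * _) s,
      mul_div_mul_left _ _ hs.ne']
  have hexp : Complex.exp (Complex.I * ((t * (l ^ 2 + 1) : ℝ) : ℂ)) =
      Complex.exp (Complex.I * (t : ℂ)) * Complex.exp (Complex.I * ((t * l ^ 2 : ℝ) : ℂ)) := by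
    rw [← Complex.exp_add]
    congr 1
    push_cast
    ring
  rw [hkernel, hexp, Complex.ofReal_mul]
  ring

/-- For fixed `s`, the weighted maximal functions differ by the factor `sinh s / s`. -/
theorem iSup_norm_hyperbolic_mul_sinh_sq (F : ℝ → ℂ) {s : ℝ} (hs : 0 < s) :
    (⨆ t ∈ Set.Ioo (0:ℝ) 1,
        ‖∫ l in Set.Ioi (0:ℝ),
            ((Real.sin (l * s) / (l * Real.sinh s) : ℝ) : ℂ) *
              Complex.exp (Complex.I * ((t * (l ^ 2 + 1) : ℝ) : ℂ)) *
              F l * ((l : ℂ)) ^ 2‖) * Real.sinh s ^ 2 =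
      Real.sinh s / s * ((⨆ t ∈ Set.Ioo (0:ℝ) 1,
        ‖∫ l in Set.Ioi (0:ℝ),
            ((Real.sin (l * s) / (l * s) : ℝ) : ℂ) *
              Complex.exp (Complex.I * ((t * l ^ 2 : ℝ) : ℂ)) *
              F l * ((l : ℂ)) ^ 2‖) * s ^ 2) := by
  have hsinh : 0 < Real.sinh s := Real.sinh_pos_iff.mpr hs
  have hfac : 0 ≤ s / Real.sinh s := by positivity
  simp_rw [norm_integral_hyperbolic_eq F hs, ← Real.mul_iSup_of_nonneg hfac]
  field_simp

/-- **Comparability of the hyperbolic and Euclidean maximal functions (proof of Thm 1.3).**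
There is `C ≥ 1` such that for every measurable `F : ℝ → ℂ` with `∫_0^∞ |F(λ)| λ² dλ < ∞`,
writing `u(s,t)` for the solution of the Schrödinger equation on ℍ³ and `ũ(s,t)` for the
Euclidean one (both with spherical Fourier transform `F`),
`(1/C) ∫_0^{100} sup_{0<t<1} |ũ(s,t)| s² ds ≤ ∫_0^{100} sup_{0<t<1} |u(s,t)| sinh²(s) ds
  ≤ C ∫_0^{100} sup_{0<t<1} |ũ(s,t)| s² ds`. -/
theorem maximal_function_comparability :
    ∃ C : ℝ, 1 ≤ C ∧ ∀ F : ℝ → ℂ, Measurable F →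
      IntegrableOn (fun l : ℝ => ‖F l‖ * l ^ 2) (Set.Ioi (0:ℝ)) →
      (ENNReal.ofReal (1 / C) *
          (∫⁻ s in Set.Ioc (0:ℝ) 100,
            ENNReal.ofReal ((⨆ t ∈ Set.Ioo (0:ℝ) 1,
                ‖∫ l in Set.Ioi (0:ℝ),
                    ((Real.sin (l * s) / (l * s) : ℝ) : ℂ) *
                      Complex.exp (Complex.I * ((t * l ^ 2 : ℝ) : ℂ)) *
                      F l * ((l : ℂ)) ^ 2‖) * s ^ 2))
          ≤ ∫⁻ s in Set.Ioc (0:ℝ) 100,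
              ENNReal.ofReal ((⨆ t ∈ Set.Ioo (0:ℝ) 1,
                  ‖∫ l in Set.Ioi (0:ℝ),
                      ((Real.sin (l * s) / (l * Real.sinh s) : ℝ) : ℂ) *
                        Complex.exp (Complex.I * ((t * (l ^ 2 + 1) : ℝ) : ℂ)) *
                        F l * ((l : ℂ)) ^ 2‖) * Real.sinh s ^ 2)) ∧
      ((∫⁻ s in Set.Ioc (0:ℝ) 100,
            ENNReal.ofReal ((⨆ t ∈ Set.Ioo (0:ℝ) 1,
                ‖∫ l in Set.Ioi (0:ℝ),
                    ((Real.sin (l * s) / (l * Real.sinh s) : ℝ) : ℂ) *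
                      Complex.exp (Complex.I * ((t * (l ^ 2 + 1) : ℝ) : ℂ)) *
                      F l * ((l : ℂ)) ^ 2‖) * Real.sinh s ^ 2))
          ≤ ENNReal.ofReal C *
            (∫⁻ s in Set.Ioc (0:ℝ) 100,
              ENNReal.ofReal ((⨆ t ∈ Set.Ioo (0:ℝ) 1,
                  ‖∫ l in Set.Ioi (0:ℝ),
                      ((Real.sin (l * s) / (l * s) : ℝ) : ℂ) *
                        Complex.exp (Complex.I * ((t * l ^ 2 : ℝ) : ℂ)) *
                        F l * ((l : ℂ)) ^ 2‖) * s ^ 2))) := by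
  refine ⟨Real.cosh 100, Real.one_le_cosh 100, fun F _ _ => ⟨?_, ?_⟩⟩
  · refine (mul_le_of_le_one_left' ?_).trans (setLIntegral_mono' measurableSet_Ioc ?_)
    · rw [ENNReal.ofReal_le_one, one_div]
      exact inv_le_one_of_one_le₀ (Real.one_le_cosh 100)
    · intro s hs
      rw [iSup_norm_hyperbolic_mul_sinh_sq F hs.1]
      refine ENNReal.ofReal_le_ofReal (le_mul_of_one_le_left (mul_nonneg ?_ (sq_nonneg s)) ?_)
      · exact Real.iSup_nonneg fun _ => Real.iSup_nonneg fun _ => norm_nonneg _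
      · rw [one_le_div hs.1]
        exact Real.self_le_sinh_iff.mpr hs.1.le
  · rw [← lintegral_const_mul' _ _ ENNReal.ofReal_ne_top]
    refine setLIntegral_mono' measurableSet_Ioc fun s hs => ?_
    rw [iSup_norm_hyperbolic_mul_sinh_sq F hs.1, ← ENNReal.ofReal_mul (Real.cosh_pos 100).le]
    refine ENNReal.ofReal_le_ofReal (mul_le_mul_of_nonneg_right ?_ (mul_nonneg ?_ (sq_nonneg s)))
    · rw [div_le_iff₀ hs.1]
      exact Real.sinh_le_cosh_mul_of_le hs.1.le hs.2
    · exact Real.iSup_nonneg fun _ => Real.iSup_nonneg fun _ => norm_nonneg _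
end

section
/- Let a > 1, B > 2 and R > 0. Then there exists c > 0, depending only on a, B and R, such that for every Lebesgue-measurable function t : (0,∞) → (0, 1) and all s, s' ∈ (0, R] with s ≠ s', the truncated oscillatory integrals satisfy, uniformly for every X > max{B/s, B/s'}: |∫_{max{B/s, B/s'}}^{X} (1 + λ²)^{-1/4} · e^{i(λ(s−s') + (t(s)−t(s')) λ^{a})} dλ| ≤ c |s − s'|^{-1/2}. -/
/-- First-derivative test: an oscillatory integral with nonnegative antitone amplitude `w` and
phase `φ` whose derivative is monotone (`φ''` has the constant sign `s`) and at least `m` in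
absolute value. -/
lemma norm_oscillatory_integral_le {w w' φ φ' φ'' : ℝ → ℝ} {p q m s : ℝ} (hpq : p ≤ q)
    (hm : 0 < m) (hs : |s| ≤ 1)
    (hw : ∀ x ∈ Set.Icc p q, HasDerivAt w (w' x) x)
    (hφ : ∀ x ∈ Set.Icc p q, HasDerivAt φ (φ' x) x)
    (hφ' : ∀ x ∈ Set.Icc p q, HasDerivAt φ' (φ'' x) x)
    (hw0 : ∀ x ∈ Set.Icc p q, 0 ≤ w x) (hw'0 : ∀ x ∈ Set.Icc p q, w' x ≤ 0)
    (hφm : ∀ x ∈ Set.Icc p q, m ≤ |φ' x|)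
    (hsφ : ∀ x ∈ Set.Icc p q, |φ'' x| = s * φ'' x)
    (hcont : Continuous fun x => (w x : ℂ) * Complex.exp (Complex.I * (φ x : ℂ))) :
    ‖∫ x in p..q, (w x : ℂ) * Complex.exp (Complex.I * (φ x : ℂ))‖ ≤ 5 * w p / m := by
  have hp : p ∈ Set.Icc p q := ⟨le_rfl, hpq⟩
  have hq : q ∈ Set.Icc p q := ⟨hpq, le_rfl⟩
  have hne : ∀ x ∈ Set.Icc p q, φ' x ≠ 0 := fun x hx h => by
    have := hφm x hx
    rw [h, abs_zero] at this
    linarith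
  have hanti : ∀ x ∈ Set.Icc p q, w x ≤ w p := by
    have : AntitoneOn w (Set.Icc p q) := by
      apply antitoneOn_of_deriv_nonpos (convex_Icc p q)
      · exact fun x hx => (hw x hx).continuousAt.continuousWithinAt
      · exact fun x hx => (hw x (interior_subset hx)).differentiableAt.differentiableWithinAt
      · intro x hx
        rw [(hw x (interior_subset hx)).deriv]
        exact hw'0 x (interior_subset hx)
    exact fun x hx => this hp hx hx.1
  have hnormexp : ∀ x : ℝ, ‖Complex.exp (Complex.I * (φ x : ℂ))‖ = 1 := fun x => by
    rw [mul_comm]; exact Complex.norm_exp_ofReal_mul_I _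
  set F : ℝ → ℂ := fun x => (w x : ℂ) * Complex.exp (Complex.I * (φ x : ℂ)) with hF
  set V : ℝ → ℂ := fun x => ((w x / φ' x : ℝ) : ℂ) *
    (-Complex.I * Complex.exp (Complex.I * (φ x : ℂ))) with hV
  have hVnorm : ∀ x ∈ Set.Icc p q, ‖V x‖ ≤ w p / m := fun x hx => by
    simp only [hV, norm_mul, norm_neg, Complex.norm_I, hnormexp, mul_one, Complex.norm_real,
      Real.norm_eq_abs, abs_div, abs_of_nonneg (hw0 x hx)]
    exact div_le_div₀ (hw0 p hp) (hanti x hx) hm (hφm x hx)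
  set v' : ℝ → ℝ := fun x => (w' x * φ' x - w x * φ'' x) / φ' x ^ 2 with hv'
  have hVd : ∀ x ∈ Set.Icc p q, HasDerivAt V
      (((v' x : ℝ) : ℂ) * (-Complex.I * Complex.exp (Complex.I * (φ x : ℂ))) + F x) x := by
    intro x hx
    have h1 := ((hw x hx).div (hφ' x hx) (hne x hx)).ofReal_comp
    have h2 := ((((hφ x hx).ofReal_comp).const_mul Complex.I).cexp).const_mul (-Complex.I)
    refine (h1.mul h2).congr_deriv ?_
    have hne' : (φ' x : ℂ) ≠ 0 := by exact_mod_cast hne x hx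
    simp only [hF, hv']
    push_cast
    have : (w x : ℂ) / φ' x * (-Complex.I * (Complex.exp (Complex.I * φ x) *
        (Complex.I * φ' x))) = -(Complex.I * Complex.I) * (w x * Complex.exp (Complex.I * φ x)) := by
      field_simp
    simp only [Pi.div_apply]
    push_cast
    rw [this, Complex.I_mul_I]
    ring
  set G : ℝ → ℝ := fun x => -(w x / m) - w p * s / φ' x with hG
  have hGd : ∀ x ∈ Set.Icc p q, HasDerivAt G (-(w' x / m) + w p * (s * φ'' x) / φ' x ^ 2) x := by
    intro x hx
    have h1 := ((hw x hx).div_const m).neg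
    have h2 := ((hφ' x hx).inv (hne x hx)).const_mul (w p * s)
    exact (h1.sub h2).congr_deriv (by ring)
  have hv'le : ∀ x ∈ Set.Icc p q, |v' x| ≤ -(w' x / m) + w p * (s * φ'' x) / φ' x ^ 2 := by
    intro x hx
    have hn := hne x hx
    have e : v' x = w' x / φ' x - w x * φ'' x / φ' x ^ 2 := by
      simp only [hv']; field_simp
    rw [e, ← hsφ x hx]
    refine (abs_sub _ _).trans (add_le_add ?_ ?_)
    · rw [abs_div, abs_of_nonpos (hw'0 x hx), ← neg_div]
      exact div_le_div_of_nonneg_left (by linarith [hw'0 x hx]) hm (hφm x hx)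
    · rw [abs_div, abs_mul, abs_of_nonneg (hw0 x hx), abs_of_nonneg (sq_nonneg (φ' x))]
      have := hanti x hx
      gcongr
  have hGq : G q - G p ≤ 3 * (w p / m) := by
    have hb : ∀ x ∈ Set.Icc p q, |w p * s / φ' x| ≤ w p / m := fun x hx => by
      rw [abs_div, abs_mul, abs_of_nonneg (hw0 p hp)]
      exact div_le_div₀ (hw0 p hp) (mul_le_of_le_one_right (hw0 p hp) hs) hm (hφm x hx)
    have h1 := abs_le.1 (hb p hp)
    have h2 := abs_le.1 (hb q hq)
    have h3 : 0 ≤ w q / m := div_nonneg (hw0 q hq) hm.le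
    simp only [hG]
    linarith
  have hId : ∀ x, HasDerivAt (fun y => ∫ z in p..y, F z) (F x) x := fun x =>
    intervalIntegral.integral_hasDerivAt_right (hcont.intervalIntegrable _ _)
      (hcont.stronglyMeasurableAtFilter _ _) hcont.continuousAt
  set H : ℝ → ℂ := fun x => (∫ z in p..x, F z) - V x + V p with hH
  have hHd : ∀ x ∈ Set.Icc p q, HasDerivAt H
      (-(((v' x : ℝ) : ℂ) * (-Complex.I * Complex.exp (Complex.I * (φ x : ℂ))))) x := by
    intro x hx
    exact (((hId x).sub (hVd x hx)).add_const (V p)).congr_deriv (by ring)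
  have key := image_norm_le_of_norm_deriv_right_le_deriv_boundary' (f := H)
    (B := fun x => G x - G p) (a := p) (b := q)
    (fun x hx => (hHd x hx).continuousAt.continuousWithinAt)
    (fun x hx => (hHd x (Set.Ico_subset_Icc_self hx)).hasDerivWithinAt)
    (by simp [hH])
    (fun x hx => ((hGd x hx).sub_const (G p)).continuousAt.continuousWithinAt)
    (fun x hx => ((hGd x (Set.Ico_subset_Icc_self hx)).sub_const (G p)).hasDerivWithinAt)
    (fun x hx => by
      rw [norm_neg, norm_mul, norm_mul, norm_neg, Complex.norm_I, hnormexp, mul_one, mul_one,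
        Complex.norm_real, Real.norm_eq_abs]
      exact hv'le x (Set.Ico_subset_Icc_self hx)) hq
  have e : (∫ z in p..q, F z) = H q + V q - V p := by simp only [hH]; ring
  rw [e]
  have h1 := norm_sub_le (H q + V q) (V p)
  have h2 := norm_add_le (H q) (V q)
  have h3 := hVnorm p hp
  have h4 := hVnorm q hq
  have h5 : 5 * w p / m = 5 * (w p / m) := by ring
  linarith

/-- The integrand `(1 + λ²)^{-1/4} e^{i(λd + τλᵃ)}`. -/
noncomputable def fractionalKernel (a d τ : ℝ) (l : ℝ) : ℂ :=
  (((1 + l ^ 2) ^ (-(1 / 4 : ℝ)) : ℝ) : ℂ) *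
    Complex.exp (Complex.I * ((l * d + τ * l ^ a : ℝ) : ℂ))

lemma continuous_fractionalKernel {a : ℝ} (ha : 1 < a) (d τ : ℝ) :
    Continuous (fractionalKernel a d τ) := by
  have h1 : Continuous fun l : ℝ => (1 + l ^ 2) ^ (-(1 / 4 : ℝ)) :=
    (by fun_prop : Continuous fun l : ℝ => 1 + l ^ 2).rpow_const
      (fun l => Or.inl (by positivity))
  have h2 : Continuous fun l : ℝ => l ^ a := Real.continuous_rpow_const (by linarith)
  unfold fractionalKernel
  fun_prop

lemma one_add_sq_rpow_le {x : ℝ} (hx : 0 < x) :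
    (1 + x ^ 2) ^ (-(1 / 4 : ℝ)) ≤ (√x)⁻¹ := by
  have h : (√x)⁻¹ = (x ^ 2) ^ (-(1 / 4 : ℝ)) := by
    rw [Real.sqrt_eq_rpow, ← Real.rpow_neg hx.le, ← Real.rpow_natCast, ← Real.rpow_mul hx.le]
    norm_num
  rw [h]
  exact Real.rpow_le_rpow_of_nonpos (by positivity) (by linarith) (by norm_num)

lemma norm_fractionalKernel_le (a d τ : ℝ) {x : ℝ} (hx : 0 < x) :
    ‖fractionalKernel a d τ x‖ ≤ (√x)⁻¹ := by
  unfold fractionalKernel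
  rw [norm_mul, mul_comm Complex.I, Complex.norm_exp_ofReal_mul_I, mul_one, Complex.norm_real,
    Real.norm_of_nonneg (by positivity)]
  exact one_add_sq_rpow_le hx

lemma norm_integral_fractionalKernel_le_of_le_abs {a : ℝ} (ha : 1 < a) (d τ : ℝ) {y p q m : ℝ}
    (hy : 0 < y) (hyp : y ≤ p) (hpq : p ≤ q) (hm : 0 < m)
    (h : ∀ x ∈ Set.Icc p q, m ≤ |d + τ * (a * x ^ (a - 1))|) :
    ‖∫ x in p..q, fractionalKernel a d τ x‖ ≤ 5 * (√y)⁻¹ / m := by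
  have hp : 0 < p := hy.trans_le hyp
  have hpos : ∀ x ∈ Set.Icc p q, 0 < x := fun x hx => hp.trans_le hx.1
  obtain ⟨s, hs, hsτ⟩ : ∃ s : ℝ, |s| ≤ 1 ∧ |τ| = s * τ := by
    rcases le_total 0 τ with h | h
    · exact ⟨1, by simp, by rw [abs_of_nonneg h, one_mul]⟩
    · exact ⟨-1, by simp, by rw [abs_of_nonpos h, neg_one_mul]⟩
  have key := norm_oscillatory_integral_le
    (w := fun x => (1 + x ^ 2) ^ (-(1 / 4 : ℝ)))
    (w' := fun x => (2 * x) * (-(1 / 4 : ℝ)) * (1 + x ^ 2) ^ (-(1 / 4 : ℝ) - 1))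
    (φ := fun x => x * d + τ * x ^ a) (φ' := fun x => d + τ * (a * x ^ (a - 1)))
    (φ'' := fun x => τ * (a * ((a - 1) * x ^ (a - 1 - 1)))) hpq hm hs
    (fun x hx => by
      have : HasDerivAt (fun x : ℝ => 1 + x ^ 2) (2 * x) x := by
        simpa using (hasDerivAt_pow 2 x).const_add 1
      exact this.rpow_const (Or.inl (by positivity)))
    (fun x hx => by
      have h1 := Real.hasDerivAt_rpow_const (p := a) (Or.inl (hpos x hx).ne')
      exact (((hasDerivAt_id x).mul_const d).add (h1.const_mul τ)).congr_deriv (by ring))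
    (fun x hx => by
      have h1 := Real.hasDerivAt_rpow_const (p := a - 1) (Or.inl (hpos x hx).ne')
      exact ((h1.const_mul a).const_mul τ).const_add d)
    (fun x _ => by positivity)
    (fun x hx => by
      have := hpos x hx
      have h1 : 0 ≤ x * (1 + x ^ 2) ^ (-(1 / 4 : ℝ) - 1) := by positivity
      linarith)
    h
    (fun x hx => by
      have := hpos x hx
      have ha' : 0 < a - 1 := by linarith
      have h1 : 0 ≤ a * ((a - 1) * x ^ (a - 1 - 1)) := by positivity
      rw [abs_mul, abs_of_nonneg h1, hsτ, mul_assoc])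
    (continuous_fractionalKernel ha d τ)
  refine key.trans ?_
  have := (one_add_sq_rpow_le hp).trans (inv_anti₀ (Real.sqrt_pos.2 hy) (Real.sqrt_le_sqrt hyp))
  gcongr

lemma norm_integral_fractionalKernel_le_sqrt (a d τ : ℝ) {p q y : ℝ} (hp : 0 < p)
    (hpq : p ≤ q) (hqy : q ≤ y) :
    ‖∫ x in p..q, fractionalKernel a d τ x‖ ≤ 2 * √y := by
  have hq : 0 < q := hp.trans_le hpq
  have hpos : ∀ x ∈ Set.uIcc p q, 0 < x := fun x hx => by
    rw [Set.uIcc_of_le hpq] at hx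
    exact hp.trans_le hx.1
  have hint : IntervalIntegrable (fun x : ℝ => (√x)⁻¹) MeasureTheory.volume p q :=
    ContinuousOn.intervalIntegrable
      (Real.continuous_sqrt.continuousOn.inv₀ fun x hx => (Real.sqrt_pos.2 (hpos x hx)).ne')
  have h1 : ∫ x in p..q, (√x)⁻¹ = 2 * √q - 2 * √p := by
    refine intervalIntegral.integral_eq_sub_of_hasDerivAt (f := fun x => 2 * √x)
      (fun x hx => ?_) hint
    have := (Real.hasDerivAt_sqrt (hpos x hx).ne').const_mul 2
    refine this.congr_deriv ?_
    have := (Real.sqrt_pos.2 (hpos x hx)).ne'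
    field_simp
  have h2 : ‖∫ x in p..q, fractionalKernel a d τ x‖ ≤ ∫ x in p..q, (√x)⁻¹ :=
    intervalIntegral.norm_integral_le_of_norm_le hpq
      (Filter.Eventually.of_forall fun x hx => norm_fractionalKernel_le a d τ (hp.trans hx.1)) hint
  have := Real.sqrt_le_sqrt hqy
  have := Real.sqrt_nonneg p
  linarith

lemma norm_integral_fractionalKernel_le_length (a d τ : ℝ) {p q y z : ℝ} (hy : 0 < y)
    (hyp : y ≤ p) (hpq : p ≤ q) (hqz : q ≤ z) :
    ‖∫ x in p..q, fractionalKernel a d τ x‖ ≤ (√y)⁻¹ * (z - y) := by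
  have h := intervalIntegral.norm_integral_le_of_norm_le_const (a := p) (b := q) (C := (√y)⁻¹)
    (f := fractionalKernel a d τ) (fun x hx => by
      rw [Set.uIoc_of_le hpq] at hx
      exact (norm_fractionalKernel_le a d τ (hy.trans_le (hyp.trans hx.1.le))).trans
        (inv_anti₀ (Real.sqrt_pos.2 hy) (Real.sqrt_le_sqrt (hyp.trans hx.1.le))))
  refine h.trans ?_
  rw [abs_of_nonneg (by linarith)]
  gcongr

/-- `f` has all its integrals over subintervals of `[A, B]` bounded by `K`. -/
def IntegralsBoundedBy (f : ℝ → ℂ) (A B K : ℝ) : Prop :=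
  ∀ p q, A ≤ p → p ≤ q → q ≤ B → ‖∫ x in p..q, f x‖ ≤ K

lemma IntegralsBoundedBy.trans {f : ℝ → ℂ} (hf : Continuous f) {A B C K K' : ℝ} (hK : 0 ≤ K)
    (hK' : 0 ≤ K') (h : IntegralsBoundedBy f A B K) (h' : IntegralsBoundedBy f B C K') :
    IntegralsBoundedBy f A C (K + K') := by
  intro p q hp hpq hq
  rcases le_total q B with h1 | h1
  · linarith [h p q hp hpq h1]
  rcases le_total B p with h2 | h2
  · linarith [h' p q h2 hpq hq]
  rw [← intervalIntegral.integral_add_adjacent_intervals (hf.intervalIntegrable p B)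
    (hf.intervalIntegrable B q)]
  exact (norm_add_le _ _).trans (add_le_add (h p B hp h2 le_rfl) (h' B q le_rfl h1 hq))

lemma IntegralsBoundedBy.mono {f : ℝ → ℂ} {A B K K' : ℝ} (h : IntegralsBoundedBy f A B K)
    (hK : K ≤ K') : IntegralsBoundedBy f A B K' :=
  fun p q hp hpq hq => (h p q hp hpq hq).trans hK

lemma min_mul_one_sub_le_one_sub_rpow {b ρ : ℝ} (hb : 0 < b) (h0 : 0 ≤ ρ) (h1 : ρ ≤ 1) :
    min b 1 * (1 - ρ) ≤ 1 - ρ ^ b := by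
  rcases le_total b 1 with h | h
  · rw [min_eq_left h]
    have := rpow_one_add_le_one_add_mul_self (s := ρ - 1) (by linarith) hb.le h
    rw [add_sub_cancel] at this
    linarith
  · rw [min_eq_right h]
    have := Real.rpow_le_rpow_of_exponent_ge_of_imp h0 h1 h (by intros; linarith)
    rw [Real.rpow_one] at this
    linarith

/-- The derivative of the phase is bounded below in terms of the distance to the stationary
point `L`. -/
lemma le_abs_phase_deriv {a d τ L : ℝ} (ha : 1 < a) (hL : 0 < L)
    (hstat : |τ| * (a * L ^ (a - 1)) = |d|) {x : ℝ} (hx : 0 < x) :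
    (x ≤ L → |d| * (min (a - 1) 1 * (1 - x / L)) ≤ |d + τ * (a * x ^ (a - 1))|) ∧
    (L ≤ x → |d| * (min (a - 1) 1 * (1 - L / x)) ≤ |d + τ * (a * x ^ (a - 1))|) := by
  have hb : 0 < a - 1 := by linarith
  have hLb : 0 < L ^ (a - 1) := Real.rpow_pos_of_pos hL _
  have hxb : 0 < x ^ (a - 1) := Real.rpow_pos_of_pos hx _
  have e1 : |τ * (a * x ^ (a - 1))| = |d| * (x / L) ^ (a - 1) := by
    rw [abs_mul, abs_of_pos (by positivity : 0 < a * x ^ (a - 1)), ← hstat,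
      Real.div_rpow hx.le hL.le]
    field_simp
  have e2 : |(|d| - |d| * (x / L) ^ (a - 1))| ≤ |d + τ * (a * x ^ (a - 1))| := by
    have := abs_abs_sub_abs_le_abs_sub d (-(τ * (a * x ^ (a - 1))))
    rwa [abs_neg, e1, sub_neg_eq_add] at this
  constructor
  · intro hxL
    have h := min_mul_one_sub_le_one_sub_rpow hb (ρ := x / L) (by positivity)
      ((div_le_one hL).2 hxL)
    have := mul_le_mul_of_nonneg_left h (abs_nonneg d)
    have := le_abs_self (|d| - |d| * (x / L) ^ (a - 1))
    linarith
  · intro hxL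
    have h := min_mul_one_sub_le_one_sub_rpow hb (ρ := L / x) (by positivity)
      ((div_le_one hx).2 hxL)
    have e3 : (L / x) ^ (a - 1) * (x / L) ^ (a - 1) = 1 := by
      rw [← Real.mul_rpow (by positivity) (by positivity)]
      field_simp
      simp
    have h3 : 1 ≤ (x / L) ^ (a - 1) := Real.one_le_rpow ((one_le_div hL).2 hxL) hb.le
    have h4 : 1 - (L / x) ^ (a - 1) ≤ (x / L) ^ (a - 1) - 1 := by
      nlinarith [sq_nonneg ((x / L) ^ (a - 1) - 1)]
    have := mul_le_mul_of_nonneg_left (h.trans h4) (abs_nonneg d)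
    have := neg_le_abs (|d| - |d| * (x / L) ^ (a - 1))
    linarith

lemma exists_stationary_point {a d τ : ℝ} (ha : 1 < a) (hd : d ≠ 0) (hτ : τ ≠ 0) :
    ∃ L : ℝ, 0 < L ∧ |τ| * (a * L ^ (a - 1)) = |d| := by
  have hd' := abs_pos.2 hd
  have hτ' := abs_pos.2 hτ
  refine ⟨(|d| / (|τ| * a)) ^ (a - 1)⁻¹, by positivity, ?_⟩
  rw [Real.rpow_inv_rpow (by positivity) (by linarith)]
  field_simp

/-- The oscillatory integral when the phase may have a stationary point. -/
lemma integralsBoundedBy_of_stationary {a d τ r l M X : ℝ} (ha : 1 < a) (hM : 0 < M) (hr : 0 < r)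
    (hl : 0 < l) (hd : |d| = r ^ 2) (hstat : |τ| * (a * (l ^ 2) ^ (a - 1)) = |d|) :
    IntegralsBoundedBy (fractionalKernel a d τ) M X ((7 + 30 / min (a - 1) 1) / r) := by
  have hc := continuous_fractionalKernel ha d τ
  have hL : 0 < l ^ 2 := by positivity
  set k := min (a - 1) 1 with hk
  have hk0 : 0 < k := lt_min (by linarith) one_pos
  have hfar : ∀ x, 0 < x → 2 * l ^ 2 ≤ x → r ^ 2 * (k / 2) ≤ |d + τ * (a * x ^ (a - 1))| := by
    intro x hx h
    refine le_trans ?_ ((le_abs_phase_deriv ha hL hstat hx).2 (by linarith))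
    have : l ^ 2 / x ≤ 1 / 2 := by rw [div_le_iff₀ hx]; linarith
    rw [hd, div_eq_mul_inv]
    gcongr
    linarith
  have hnear : ∀ x, 0 < x → x ≤ l ^ 2 / 2 → r ^ 2 * (k / 2) ≤ |d + τ * (a * x ^ (a - 1))| := by
    intro x hx h
    refine le_trans ?_ ((le_abs_phase_deriv ha hL hstat hx).1 (by linarith))
    have : x / l ^ 2 ≤ 1 / 2 := by rw [div_le_iff₀ hL]; linarith
    rw [hd, div_eq_mul_inv]
    gcongr
    linarith
  rcases le_or_gt (l * r) 2 with hlr | hlr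
  · have h1 : IntegralsBoundedBy (fractionalKernel a d τ) M ((3 / r) ^ 2) (6 / r) := by
      intro p q hp hpq hq
      convert norm_integral_fractionalKernel_le_sqrt a d τ (hM.trans_le hp) hpq hq using 1
      rw [Real.sqrt_sq (by positivity)]
      ring
    have h2 : IntegralsBoundedBy (fractionalKernel a d τ) ((3 / r) ^ 2) X (10 / 3 / k / r) := by
      intro p q hp hpq hq
      have hp0 : 0 < (3 / r) ^ 2 := by positivity
      convert norm_integral_fractionalKernel_le_of_le_abs ha d τ hp0 hp hpq
        (by positivity : 0 < r ^ 2 * (k / 2)) (fun x hx => hfar x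
          (hp0.trans_le (hp.trans hx.1)) ?_) using 1
      · rw [Real.sqrt_sq (by positivity)]
        field_simp
        ring
      · refine le_trans ?_ (hp.trans hx.1)
        rw [div_pow, le_div_iff₀ (by positivity)]
        nlinarith [mul_pos hl hr]
    refine (h1.trans hc (by positivity) (by positivity) h2).mono ?_
    have : (7 + 30 / k) / r - (6 / r + 10 / 3 / k / r) = (1 + 80 / 3 / k) / r := by
      field_simp; ring
    have : 0 ≤ (1 + 80 / 3 / k) / r := by positivity
    linarith
  · set ε := 1 / (l * r) with hε
    have hε0 : 0 < ε := by positivity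
    have hε2 : ε < 1 / 2 := by
      rw [hε]; exact one_div_lt_one_div_of_lt two_pos hlr
    have h1 : IntegralsBoundedBy (fractionalKernel a d τ) M ((1 / r) ^ 2) (2 / r) := by
      intro p q hp hpq hq
      convert norm_integral_fractionalKernel_le_sqrt a d τ (hM.trans_le hp) hpq hq using 1
      rw [Real.sqrt_sq (by positivity)]
      ring
    have h2 : IntegralsBoundedBy (fractionalKernel a d τ) ((1 / r) ^ 2) (l ^ 2 / 2)
        (10 / k / r) := by
      intro p q hp hpq hq
      have hp0 : 0 < (1 / r) ^ 2 := by positivity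
      convert norm_integral_fractionalKernel_le_of_le_abs ha d τ hp0 hp hpq
        (by positivity : 0 < r ^ 2 * (k / 2)) (fun x hx => hnear x
          (hp0.trans_le (hp.trans hx.1)) (hx.2.trans hq)) using 1
      rw [Real.sqrt_sq (by positivity)]
      field_simp
      ring
    have h3 : IntegralsBoundedBy (fractionalKernel a d τ) (l ^ 2 / 2) (l ^ 2 * (1 - ε))
        (10 / k / r) := by
      intro p q hp hpq hq
      convert norm_integral_fractionalKernel_le_of_le_abs ha d τ
        (by positivity : 0 < (l / 2) ^ 2) (by nlinarith) hpq
        (by positivity : 0 < r ^ 2 * (k * ε)) (fun x hx => ?_) using 1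
      · rw [Real.sqrt_sq (by positivity), hε]
        field_simp
        ring
      · have hx0 : 0 < x := by linarith [hx.1]
        have hxq : x / l ^ 2 ≤ 1 - ε := by
          rw [div_le_iff₀ hL]; linarith [hx.2]
        refine le_trans ?_ ((le_abs_phase_deriv ha hL hstat hx0).1 (by nlinarith [hx.2]))
        rw [hd]
        gcongr
        linarith
    have h4 : IntegralsBoundedBy (fractionalKernel a d τ) (l ^ 2 * (1 - ε)) (l ^ 2 * (1 + ε))
        (4 / r) := by
      intro p q hp hpq hq
      have hy : 0 < l ^ 2 * (1 - ε) := mul_pos hL (by linarith)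
      refine (norm_integral_fractionalKernel_le_length a d τ hy hp hpq hq).trans ?_
      have hs : l / 2 ≤ √(l ^ 2 * (1 - ε)) := Real.le_sqrt_of_sq_le (by nlinarith)
      have hs' := inv_anti₀ (by positivity) hs
      have e : l ^ 2 * (1 + ε) - l ^ 2 * (1 - ε) = 2 * l / r := by
        rw [hε]; field_simp; ring
      rw [e]
      calc (√(l ^ 2 * (1 - ε)))⁻¹ * (2 * l / r) ≤ (l / 2)⁻¹ * (2 * l / r) := by gcongr
        _ = 4 / r := by field_simp; ring
    have h5 : IntegralsBoundedBy (fractionalKernel a d τ) (l ^ 2 * (1 + ε)) X (10 / k / r) := by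
      intro p q hp hpq hq
      convert norm_integral_fractionalKernel_le_of_le_abs ha d τ hL (by nlinarith) hpq
        (by positivity : 0 < r ^ 2 * (k * (ε / 2))) (fun x hx => ?_) using 1
      · rw [Real.sqrt_sq hl.le, hε]
        field_simp
        ring
      · have hxp := hp.trans hx.1
        have hx0 : 0 < x := lt_of_lt_of_le (by positivity) hxp
        have hxq : l ^ 2 / x ≤ 1 - ε / 2 := by
          rw [div_le_iff₀ hx0]
          have h6 : 1 ≤ (1 - ε / 2) * (1 + ε) := by nlinarith
          have h7 := mul_le_mul_of_nonneg_left hxp (by linarith : 0 ≤ 1 - ε / 2)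
          nlinarith
        refine le_trans ?_ ((le_abs_phase_deriv ha hL hstat hx0).2 (by nlinarith))
        rw [hd]
        gcongr
        linarith
    have hkr : 0 ≤ 10 / k / r := by positivity
    have h2r : 0 ≤ 2 / r := by positivity
    have h4r : 0 ≤ 4 / r := by positivity
    refine ((((h1.trans hc h2r hkr h2).trans hc (by positivity) hkr h3).trans hc
      (by positivity) h4r h4).trans hc (by positivity) hkr h5).mono ?_
    have : (7 + 30 / k) / r - (2 / r + 10 / k / r + 10 / k / r + 4 / r + 10 / k / r) = 1 / r := by
      field_simp; ring
    have : 0 ≤ 1 / r := by positivity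
    linarith

lemma integralsBoundedBy_of_mul_nonneg {a d τ r M X : ℝ} (ha : 1 < a) (hM : 0 < M) (hr : 0 < r)
    (hd : |d| = r ^ 2) (hdτ : 0 ≤ d * τ) :
    IntegralsBoundedBy (fractionalKernel a d τ) M X (7 / r) := by
  have h1 : IntegralsBoundedBy (fractionalKernel a d τ) M ((1 / r) ^ 2) (2 / r) := by
    intro p q hp hpq hq
    convert norm_integral_fractionalKernel_le_sqrt a d τ (hM.trans_le hp) hpq hq using 1
    rw [Real.sqrt_sq (by positivity)]
    ring
  have h2 : IntegralsBoundedBy (fractionalKernel a d τ) ((1 / r) ^ 2) X (5 / r) := by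
    intro p q hp hpq hq
    have hp0 : 0 < (1 / r) ^ 2 := by positivity
    convert norm_integral_fractionalKernel_le_of_le_abs ha d τ hp0 hp hpq
      (by positivity : 0 < r ^ 2) (fun x hx => ?_) using 1
    · rw [Real.sqrt_sq (by positivity)]
      field_simp
    · have hx0 : 0 < x := hp0.trans_le (hp.trans hx.1)
      have hax : 0 ≤ a * x ^ (a - 1) := by positivity
      rw [← hd]
      apply sq_le_sq.1
      nlinarith [mul_nonneg hdτ hax, sq_nonneg (τ * (a * x ^ (a - 1)))]
  refine (h1.trans (continuous_fractionalKernel ha d τ) (by positivity) (by positivity) h2).mono ?_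
  apply le_of_eq
  ring


/-- **Oscillatory integral estimate for the fractional Schrödinger equation (shifted
Laplacian).** Let `a > 1`, `B > 2`, `R > 0`. There is `c > 0` (depending only on `a`, `B`, `R`)
such that for every measurable `t : (0,∞) → (0,1)` and all `s, s' ∈ (0, R]` with `s ≠ s'`,
uniformly in every truncation `X > max (B/s) (B/s')`,
`|∫_{max(B/s, B/s')}^{X} (1 + λ²)^{-1/4} e^{i(λ(s-s') + (t(s)-t(s')) λᵃ)} dλ| ≤ c |s - s'|^{-1/2}`. -/
theorem fractional_oscillatory_integral_estimate
    (a B R : ℝ) (ha : 1 < a) (hB : 2 < B) (hR : 0 < R) :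
    ∃ c : ℝ, 0 < c ∧
      ∀ t : ℝ → ℝ, Measurable t → (∀ u : ℝ, 0 < u → t u ∈ Set.Ioo 0 1) →
      ∀ s s' : ℝ, s ∈ Set.Ioc 0 R → s' ∈ Set.Ioc 0 R → s ≠ s' →
      ∀ X : ℝ, max (B / s) (B / s') < X →
      ‖∫ l in (max (B / s) (B / s'))..X,
          (((1 + l ^ 2) ^ (-(1 / 4 : ℝ)) : ℝ) : ℂ) *
            Complex.exp (Complex.I *
              ((l * (s - s') + (t s - t s') * l ^ a : ℝ) : ℂ))‖
        ≤ c * |s - s'| ^ (-(1 / 2 : ℝ)) := by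
  have hk : 0 < min (a - 1) 1 := lt_min (by linarith) one_pos
  refine ⟨7 + 30 / min (a - 1) 1, by positivity, ?_⟩
  intro t _ _ s s' hs hs' hne X hX
  have hd : s - s' ≠ 0 := sub_ne_zero.2 hne
  have hd0 : 0 < |s - s'| := abs_pos.2 hd
  have hM : 0 < max (B / s) (B / s') := lt_max_of_lt_left (div_pos (by linarith) hs.1)
  have hr : 0 < √|s - s'| := Real.sqrt_pos.2 hd0
  have hr2 : |s - s'| = √|s - s'| ^ 2 := (Real.sq_sqrt hd0.le).symm
  have e : |s - s'| ^ (-(1 / 2 : ℝ)) = (√|s - s'|)⁻¹ := by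
    rw [Real.rpow_neg hd0.le, Real.sqrt_eq_rpow]
  rw [e, ← div_eq_mul_inv]
  suffices h : IntegralsBoundedBy (fractionalKernel a (s - s') (t s - t s'))
      (max (B / s) (B / s')) X ((7 + 30 / min (a - 1) 1) / √|s - s'|) from
    h _ _ le_rfl hX.le le_rfl
  rcases le_or_gt 0 ((s - s') * (t s - t s')) with h | h
  · refine (integralsBoundedBy_of_mul_nonneg ha hM hr hr2 h).mono ?_
    gcongr
    have : 0 ≤ 30 / min (a - 1) 1 := by positivity
    linarith
  · obtain ⟨L, hL, hstat⟩ := exists_stationary_point ha hd (right_ne_zero_of_mul h.ne)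
    rw [← Real.sq_sqrt hL.le] at hstat
    exact integralsBoundedBy_of_stationary ha hM hr (Real.sqrt_pos.2 hL) hr2 hstat
end
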